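/- arXiv:1907.12043 — 2 statements merged into one kernel-verified Lean document; each statement's English description precedes it below -/
import Mathlib

section
/- Let H be a fixed graph and let d ≥ 1 be an integer. Then with probability tending to 1 as n → ∞, the minimum degree of G(H,n,p_d^-(H)) is strictly less than d, and the minimum degree of G(H,n,p_d^+(H)) is at least d. -/
open Filter

namespace RandomMotif

/-- `G` is a *copy* of `H` in the complete graph on `Fin n`: the image of `H`
under an injection of its vertices into `Fin n`. -/
def IsCopy {k n : ℕ} (H : SimpleGraph (Fin k)) (G : SimpleGraph (Fin n)) : Prop :=
  ∃ f : Fin k ↪ Fin n, G = H.map f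

/-- The type of copies of `H` in `K_n`. -/
abbrev Copy {k : ℕ} (H : SimpleGraph (Fin k)) (n : ℕ) : Type :=
  {G : SimpleGraph (Fin n) // IsCopy H G}

/-- The graph spanned by the selected copies. -/
noncomputable def graphOf {k n : ℕ} {H : SimpleGraph (Fin k)} (ω : Copy H n → Bool) :
    SimpleGraph (Fin n) :=
  ⨆ c : Copy H n, if ω c then c.1 else ⊥

open Classical in
/-- The probability, in the binomial random motif model `G(H,n,p)` (each copy of `H`
in `K_n` is included independently with probability `p`), of the event `P` on the
family of selected copies. -/
noncomputable def selProb {k : ℕ} (H : SimpleGraph (Fin k)) (n : ℕ) (p : ℝ)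
    (P : (Copy H n → Bool) → Prop) : ℝ :=
  ∑ ω : Copy H n → Bool,
    (∏ c : Copy H n, if ω c then p else 1 - p) * (if P ω then 1 else 0)

/-- The probability that `G(H,n,p)` satisfies the graph predicate `Q`. -/
noncomputable def motifProb {k : ℕ} (H : SimpleGraph (Fin k)) (n : ℕ) (p : ℝ)
    (Q : SimpleGraph (Fin n) → Prop) : ℝ :=
  selProb H n p (fun ω => Q (graphOf ω))

/-- `mr H n r` is the number of copies of `H` in `K_n` whose vertex set meets
`[r] = {0,…,r-1}`. -/
noncomputable def mr {k : ℕ} (H : SimpleGraph (Fin k)) (n r : ℕ) : ℕ :=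
  Nat.card {G : SimpleGraph (Fin n) // IsCopy H G ∧ ∃ v ∈ G.support, (v : ℕ) < r}

/-- The minimum degree `δ(H)`. -/
noncomputable def minDeg {k : ℕ} (H : SimpleGraph (Fin k)) : ℕ :=
  ⨅ v, (H.neighborSet v).ncard

/-- `δ_d(H) = ⌈d / δ(H)⌉ - 1`. -/
noncomputable def deltad {k : ℕ} (H : SimpleGraph (Fin k)) (d : ℕ) : ℕ :=
  ⌈(d : ℝ) / (minDeg H : ℝ)⌉₊ - 1

/-- `p_d^-(H) = (ln n + δ_d(H) ln ln n - x(n)) / m_1(H)`, where `x` is a fixed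
function with `1 ≪ x(n) ≪ ln ln n`. -/
noncomputable def pMinus {k : ℕ} (H : SimpleGraph (Fin k)) (d : ℕ) (x : ℕ → ℝ) (n : ℕ) : ℝ :=
  (Real.log n + (deltad H d) * Real.log (Real.log n) - x n) / (mr H n 1)

/-- `p_d^+(H) = (ln n + δ_d(H) ln ln n + x(n)) / m_1(H)`, where `x` is a fixed
function with `1 ≪ x(n) ≪ ln ln n`. -/
noncomputable def pPlus {k : ℕ} (H : SimpleGraph (Fin k)) (d : ℕ) (x : ℕ → ℝ) (n : ℕ) : ℝ :=
  (Real.log n + (deltad H d) * Real.log (Real.log n) + x n) / (mr H n 1)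

section BinomialSubset

variable {α : Type*}

/-- Expectation of `F` over a random subset of `A` that contains each element
independently with probability `p`. -/
noncomputable def bmean (p : ℝ) (A : Finset α) (F : Finset α → ℝ) : ℝ :=
  ∑ S ∈ A.powerset, p ^ S.card * (1 - p) ^ (A.card - S.card) * F S

open Classical in
/-- Probability of `P` for a random subset of `A` that contains each element
independently with probability `p`. -/
noncomputable def bprob (p : ℝ) (A : Finset α) (P : Finset α → Prop) : ℝ :=
  bmean p A (fun S => if P S then 1 else 0)

lemma bmean_empty (p : ℝ) (F : Finset α → ℝ) : bmean p ∅ F = F ∅ := by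
  simp [bmean]

lemma bmean_congr (p : ℝ) {A : Finset α} {F G : Finset α → ℝ} (h : ∀ S ⊆ A, F S = G S) :
    bmean p A F = bmean p A G :=
  Finset.sum_congr rfl fun S hS => by rw [h S (Finset.mem_powerset.1 hS)]

lemma bmean_mono {p : ℝ} (h0 : 0 ≤ p) (h1 : p ≤ 1) {A : Finset α} {F G : Finset α → ℝ}
    (h : ∀ S ⊆ A, F S ≤ G S) : bmean p A F ≤ bmean p A G := by
  refine Finset.sum_le_sum fun S hS => ?_
  have := sub_nonneg.2 h1
  have := h S (Finset.mem_powerset.1 hS)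
  gcongr

lemma bmean_add (p : ℝ) (A : Finset α) (F G : Finset α → ℝ) :
    bmean p A (fun S => F S + G S) = bmean p A F + bmean p A G := by
  simp [bmean, mul_add, Finset.sum_add_distrib]

lemma bmean_mul_left (p : ℝ) (A : Finset α) (c : ℝ) (F : Finset α → ℝ) :
    bmean p A (fun S => c * F S) = c * bmean p A F := by
  simp only [bmean, Finset.mul_sum]
  exact Finset.sum_congr rfl fun S _ => by ring

lemma bmean_mul_right (p : ℝ) (A : Finset α) (c : ℝ) (F : Finset α → ℝ) :
    bmean p A (fun S => F S * c) = bmean p A F * c := by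
  simp only [bmean, Finset.sum_mul]
  exact Finset.sum_congr rfl fun S _ => by ring

lemma bmean_sum (p : ℝ) (A : Finset α) {ι : Type*} (s : Finset ι) (F : ι → Finset α → ℝ) :
    bmean p A (fun S => ∑ i ∈ s, F i S) = ∑ i ∈ s, bmean p A (F i) := by
  simp only [bmean, Finset.mul_sum]
  exact Finset.sum_comm

lemma bmean_const (p : ℝ) (A : Finset α) (c : ℝ) : bmean p A (fun _ => c) = c := by
  simp only [bmean, ← Finset.sum_mul, Finset.sum_pow_mul_eq_add_pow]
  simp

lemma bprob_congr (p : ℝ) {A : Finset α} {P Q : Finset α → Prop} (h : ∀ S ⊆ A, P S ↔ Q S) :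
    bprob p A P = bprob p A Q :=
  by
  classical
  unfold bprob
  exact bmean_congr p fun S hS => if_congr (h S hS) rfl rfl

lemma bprob_mono {p : ℝ} (h0 : 0 ≤ p) (h1 : p ≤ 1) {A : Finset α} {P Q : Finset α → Prop}
    (h : ∀ S ⊆ A, P S → Q S) : bprob p A P ≤ bprob p A Q := by
  refine bmean_mono h0 h1 fun S hS => ?_
  have := h S hS
  split_ifs <;> simp_all

lemma bprob_nonneg {p : ℝ} (h0 : 0 ≤ p) (h1 : p ≤ 1) (A : Finset α) (P : Finset α → Prop) :
    0 ≤ bprob p A P := by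
  rw [← bmean_const p A 0]
  exact bmean_mono h0 h1 fun S _ => by split_ifs <;> simp

lemma bprob_or_le {p : ℝ} (h0 : 0 ≤ p) (h1 : p ≤ 1) (A : Finset α) (P Q : Finset α → Prop) :
    bprob p A (fun S => P S ∨ Q S) ≤ bprob p A P + bprob p A Q := by
  unfold bprob
  rw [← bmean_add]
  refine bmean_mono h0 h1 fun S _ => ?_
  by_cases hP : P S <;> by_cases hQ : Q S <;> simp [hP, hQ]

lemma bprob_exists_le {p : ℝ} (h0 : 0 ≤ p) (h1 : p ≤ 1) (A : Finset α) {ι : Type*}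
    (s : Finset ι) (P : ι → Finset α → Prop) :
    bprob p A (fun S => ∃ i ∈ s, P i S) ≤ ∑ i ∈ s, bprob p A (P i) := by
  classical
  unfold bprob
  rw [← bmean_sum]
  refine bmean_mono h0 h1 fun S _ => ?_
  split_ifs with h
  · obtain ⟨i, hi, hP⟩ := h
    refine le_trans ?_ (Finset.single_le_sum (fun j _ => ?_) hi)
    · simp [hP]
    · split_ifs <;> simp
  · exact Finset.sum_nonneg fun j _ => by split_ifs <;> simp

lemma bprob_not (p : ℝ) (A : Finset α) (P : Finset α → Prop) :
    bprob p A (fun S => ¬ P S) = 1 - bprob p A P := by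
  rw [eq_sub_iff_add_eq, bprob, bprob, ← bmean_add, ← bmean_const p A 1]
  exact bmean_congr p fun S _ => by
    rw [bmean_const]
    by_cases h : P S <;> simp [h]

lemma bprob_superset (p : ℝ) (T : Finset α) : bprob p T (fun S => T ⊆ S) = p ^ T.card := by
  classical
  unfold bprob bmean
  rw [Finset.sum_eq_single_of_mem T (by simp)]
  · simp
  · intro S hS hne
    have : ¬ T ⊆ S := fun h => hne (Finset.Subset.antisymm (Finset.mem_powerset.1 hS) h)
    simp [this]

/-- Lower tail of a binomial random variable. -/
lemma bprob_card_le_le {p L t : ℝ} {m s r : ℕ} (h0 : 0 ≤ p) (h1 : p ≤ 1) {A : Finset α}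
    (hAm : A.card ≤ m) (hmA : m ≤ A.card + s) (hL : L = m * p) (hL1 : 1 ≤ L)
    (ht : p * (s + r) ≤ t) :
    bprob p A (fun S => S.card ≤ r) ≤ (r + 1) * L ^ r * Real.exp (t - L) := by
  classical
  unfold bprob bmean
  refine le_of_eq_of_le (Eq.trans (Finset.sum_congr rfl fun S _ => ?_)
    (Finset.sum_powerset_apply_card (x := A)
      (fun j => p ^ j * (1 - p) ^ (A.card - j) * if j ≤ r then (1 : ℝ) else 0))) ?_
  · by_cases h : S.card ≤ r <;> simp [h]
  have key : ∀ j ∈ Finset.range (A.card + 1),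
      A.card.choose j • (p ^ j * (1 - p) ^ (A.card - j) * if j ≤ r then (1 : ℝ) else 0) ≤
        if j ≤ r then L ^ r * Real.exp (t - L) else 0 := by
    intro j hj
    split_ifs with hjr
    · have hjA : j ≤ A.card := Nat.lt_succ_iff.1 (Finset.mem_range.1 hj)
      have e1 : (A.card.choose j : ℝ) ≤ (m : ℝ) ^ j := by
        calc (A.card.choose j : ℝ) ≤ (A.card : ℝ) ^ j := by exact_mod_cast Nat.choose_le_pow _ _
          _ ≤ (m : ℝ) ^ j := by gcongr
      have e2 : (1 - p) ^ (A.card - j) ≤ Real.exp (t - L) := by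
        calc (1 - p) ^ (A.card - j) ≤ Real.exp (-p) ^ (A.card - j) := by
              have := sub_nonneg.2 h1
              gcongr
              have := Real.add_one_le_exp (-p)
              linarith
          _ = Real.exp (-(p * ((A.card : ℝ) - j))) := by
              rw [← Real.exp_nat_mul, Nat.cast_sub hjA]; congr 1; ring
          _ ≤ Real.exp (t - L) := by
              apply Real.exp_le_exp.2
              have a1 : (m : ℝ) ≤ A.card + s := by exact_mod_cast hmA
              have a2 : (j : ℝ) ≤ r := by exact_mod_cast hjr
              have : p * ((m : ℝ) - s - r) ≤ p * ((A.card : ℝ) - j) := by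
                gcongr
                linarith
              rw [hL]; linarith
      have e3 : L ^ j ≤ L ^ r := pow_le_pow_right₀ hL1 hjr
      rw [nsmul_eq_mul, mul_one]
      have := pow_nonneg (sub_nonneg.2 h1) (A.card - j)
      calc (A.card.choose j : ℝ) * (p ^ j * (1 - p) ^ (A.card - j))
          ≤ (m : ℝ) ^ j * (p ^ j * (1 - p) ^ (A.card - j)) := by gcongr
        _ = L ^ j * (1 - p) ^ (A.card - j) := by rw [hL, mul_pow]; ring
        _ ≤ L ^ r * Real.exp (t - L) := by gcongr
    · simp
  refine (Finset.sum_le_sum key).trans ?_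
  rw [← Finset.sum_filter, Finset.sum_const, nsmul_eq_mul, mul_assoc]
  gcongr
  have : ((Finset.range (A.card + 1)).filter (fun j => j ≤ r)).card ≤ r + 1 := by
    rw [← Finset.card_range (r + 1)]
    refine Finset.card_le_card fun j => ?_
    simp only [Finset.mem_filter, Finset.mem_range]
    omega
  exact_mod_cast this

variable [DecidableEq α]

lemma bmean_insert (p : ℝ) {a : α} {A : Finset α} (ha : a ∉ A) (F : Finset α → ℝ) :
    bmean p (insert a A) F =
      p * bmean p A (fun S => F (insert a S)) + (1 - p) * bmean p A F := by
  unfold bmean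
  rw [Finset.sum_powerset_insert ha, add_comm, Finset.mul_sum, Finset.mul_sum]
  congr 1
  · refine Finset.sum_congr rfl fun S hS => ?_
    have hS' := Finset.mem_powerset.1 hS
    rw [Finset.card_insert_of_notMem ha, Finset.card_insert_of_notMem (fun h => ha (hS' h)),
      Nat.add_sub_add_right]
    ring
  · refine Finset.sum_congr rfl fun S hS => ?_
    have hS' := Finset.card_le_card (Finset.mem_powerset.1 hS)
    rw [Finset.card_insert_of_notMem ha, Nat.sub_add_comm hS']
    ring

lemma bmean_union (p : ℝ) {A B : Finset α} (h : Disjoint A B) (F : Finset α → ℝ) :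
    bmean p (A ∪ B) F = bmean p A (fun S => bmean p B (fun T => F (S ∪ T))) := by
  induction A using Finset.induction_on generalizing F with
  | empty => simp [bmean_empty]
  | insert a A ha ih =>
    rw [Finset.disjoint_insert_left] at h
    have : a ∉ A ∪ B := by simp [ha, h.1]
    rw [Finset.insert_union, bmean_insert p this, bmean_insert p ha, ih h.2, ih h.2]
    simp [Finset.insert_union]

/-- Functions of the random set on disjoint blocks are independent. -/
lemma bmean_inter_mul (p : ℝ) {A B U : Finset α} (hA : A ⊆ U) (hB : B ⊆ U) (h : Disjoint A B)
    (F G : Finset α → ℝ) :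
    bmean p U (fun S => F (S ∩ A) * G (S ∩ B)) = bmean p A F * bmean p B G := by
  have hU : U = A ∪ (B ∪ (U \ (A ∪ B))) := by
    rw [← Finset.union_assoc, Finset.union_sdiff_of_subset (Finset.union_subset hA hB)]
  have d1 : Disjoint A (B ∪ (U \ (A ∪ B))) := by
    rw [Finset.disjoint_union_right]
    exact ⟨h, Finset.disjoint_sdiff.mono_left Finset.subset_union_left⟩
  have d2 : Disjoint B (U \ (A ∪ B)) :=
    Finset.disjoint_sdiff.mono_left Finset.subset_union_right
  rw [hU, bmean_union p d1, ← bmean_mul_right]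
  refine bmean_congr p fun S hS => ?_
  rw [bmean_union p d2, ← bmean_mul_left]
  refine bmean_congr p fun T hT => ?_
  rw [← bmean_const p (U \ (A ∪ B)) (F S * G T)]
  refine bmean_congr p fun W hW => ?_
  have e1 : (S ∪ (T ∪ W)) ∩ A = S := by
    ext x
    have := @hS x; have := @hT x; have := @hW x
    have hh : x ∈ A → x ∉ B := fun hx => Finset.disjoint_left.1 h hx
    simp only [Finset.mem_inter, Finset.mem_union, Finset.mem_sdiff] at *
    tauto
  have e2 : (S ∪ (T ∪ W)) ∩ B = T := by
    ext x
    have := @hS x; have := @hT x; have := @hW x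
    have hh : x ∈ A → x ∉ B := fun hx => Finset.disjoint_left.1 h hx
    simp only [Finset.mem_inter, Finset.mem_union, Finset.mem_sdiff] at *
    tauto
  rw [e1, e2]

lemma bmean_inter (p : ℝ) {A U : Finset α} (hA : A ⊆ U) (F : Finset α → ℝ) :
    bmean p U (fun S => F (S ∩ A)) = bmean p A F := by
  have := bmean_inter_mul p hA (Finset.empty_subset U) (Finset.disjoint_empty_right A) F
    (fun _ => 1)
  simpa [bmean_const] using this

lemma bprob_inter (p : ℝ) {A U : Finset α} (hA : A ⊆ U) (P : Finset α → Prop) :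
    bprob p U (fun S => P (S ∩ A)) = bprob p A P := by
  classical
  exact bmean_inter p hA (fun S => if P S then 1 else 0)

lemma bprob_inter_and (p : ℝ) {A B U : Finset α} (hA : A ⊆ U) (hB : B ⊆ U) (h : Disjoint A B)
    (P Q : Finset α → Prop) :
    bprob p U (fun S => P (S ∩ A) ∧ Q (S ∩ B)) = bprob p A P * bprob p B Q := by
  classical
  rw [bprob, bprob, bprob, ← bmean_inter_mul p hA hB h]
  exact bmean_congr p fun S _ => by
    by_cases h : P (S ∩ A) <;> by_cases h' : Q (S ∩ B) <;> simp [h, h']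

lemma bprob_superset_and (p : ℝ) {T B U : Finset α} (hT : T ⊆ U) (hB : B ⊆ U)
    (h : Disjoint T B) (Q : Finset α → Prop) :
    bprob p U (fun S => T ⊆ S ∧ Q (S ∩ B)) = p ^ T.card * bprob p B Q := by
  rw [← bprob_superset, ← bprob_inter_and p hT hB h]
  exact bprob_congr p fun S _ => by simp [Finset.subset_inter_iff]

lemma bprob_superset_of_subset (p : ℝ) {T U : Finset α} (hT : T ⊆ U) :
    bprob p U (fun S => T ⊆ S) = p ^ T.card := by
  rw [← bprob_superset, ← bprob_inter p hT]
  exact bprob_congr p fun S _ => by simp [Finset.subset_inter_iff]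

lemma sum_prod_bool_eq_bmean [Fintype α] (p : ℝ) (F : (α → Bool) → ℝ) :
    ∑ ω : α → Bool, (∏ c, if ω c then p else 1 - p) * F ω =
      bmean p Finset.univ (fun S => F (fun c => decide (c ∈ S))) := by
  unfold bmean
  rw [Finset.powerset_univ]
  refine (Fintype.sum_equiv
    { toFun := fun S c => decide (c ∈ S)
      invFun := fun ω => Finset.univ.filter (fun c => ω c = true)
      left_inv := fun S => by ext; simp
      right_inv := fun ω => by ext; simp } _ _ fun S => ?_).symm
  simp only [Equiv.coe_fn_mk, decide_eq_true_eq]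
  rw [Finset.prod_ite, Finset.prod_const, Finset.prod_const, Finset.filter_mem_eq_inter,
    Finset.univ_inter, Finset.filter_not, Finset.filter_mem_eq_inter, Finset.univ_inter,
    Finset.card_sdiff_of_subset (Finset.subset_univ S)]

end BinomialSubset

section RandomSubsetEvents

variable {α V : Type*} [DecidableEq α]

lemma bprob_subset_card_eq (p : ℝ) {A B : Finset α} (hB : B ⊆ A) (r : ℕ) :
    bprob p A (fun S => S ⊆ B ∧ S.card = r) =
      (B.card.choose r : ℝ) * (p ^ r * (1 - p) ^ (A.card - r)) := by
  classical
  unfold bprob bmean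
  simp only [mul_ite, mul_one, mul_zero]
  rw [← Finset.sum_filter]
  have : A.powerset.filter (fun S => S ⊆ B ∧ S.card = r) = B.powersetCard r := by
    ext S
    simp only [Finset.mem_filter, Finset.mem_powerset, Finset.mem_powersetCard]
    exact ⟨fun h => h.2, fun h => ⟨h.1.trans hB, h⟩⟩
  rw [this, Finset.sum_congr rfl (g := fun _ => p ^ r * (1 - p) ^ (A.card - r))]
  · simp
  · intro S hS
    rw [(Finset.mem_powersetCard.1 hS).2]

/-- If a large subfamily of `C` always contains an overlapping pair on the event `Bad`, then
`Bad` forces either few members of `C`, or an overlapping pair with few others, or two disjoint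
overlapping pairs. -/
lemma bprob_le_of_overlap {p β K : ℝ} (h0 : 0 ≤ p) (h1 : p ≤ 1) {r : ℕ} {U C : Finset α}
    (hC : C ⊆ U) {M : Finset (α × α)} (hM : ∀ q ∈ M, q.1 ∈ C ∧ q.2 ∈ C ∧ q.1 ≠ q.2)
    {Bad : Finset α → Prop}
    (hBad : ∀ S W, W ⊆ S → W ⊆ C → Bad S → r < W.card → ∃ q ∈ M, q.1 ∈ W ∧ q.2 ∈ W)
    (hβ : ∀ A ⊆ C, C.card ≤ A.card + 2 → bprob p A (fun S => S.card ≤ r) ≤ β)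
    (hK : M.card * p ^ 2 ≤ K) :
    bprob p U Bad ≤ β + K * (β + K) := by
  classical
  have hβ0 : 0 ≤ β := (bprob_nonneg h0 h1 _ _).trans (hβ C subset_rfl (by omega))
  have hK0 : 0 ≤ K := le_trans (by positivity) hK
  let T : α × α → Finset α := fun q => {q.1, q.2}
  have hT : ∀ q ∈ M, T q ⊆ C ∧ (T q).card = 2 := by
    intro q hq
    obtain ⟨a, b, c⟩ := hM q hq
    refine ⟨?_, Finset.card_pair c⟩
    intro x hx
    simp only [T, Finset.mem_insert, Finset.mem_singleton] at hx
    rcases hx with rfl | rfl <;> assumption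
  let R : α × α → Finset α := fun q => C \ T q
  let Q : α × α → Finset α → Prop := fun q S =>
    S.card ≤ r ∨ ∃ e ∈ M.filter (fun e => T e ⊆ R q), T e ⊆ S
  have incl : ∀ S, Bad S → (S ∩ C).card ≤ r ∨ ∃ q ∈ M, T q ⊆ S ∧ Q q (S ∩ R q) := by
    intro S hS
    by_cases hc : (S ∩ C).card ≤ r
    · exact Or.inl hc
    right
    obtain ⟨q, hq, hq1, hq2⟩ := hBad S (S ∩ C) Finset.inter_subset_left
      Finset.inter_subset_right hS (not_le.1 hc)
    have hTq : T q ⊆ S := by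
      intro x hx
      simp only [T, Finset.mem_insert, Finset.mem_singleton] at hx
      rcases hx with rfl | rfl
      · exact (Finset.mem_inter.1 hq1).1
      · exact (Finset.mem_inter.1 hq2).1
    refine ⟨q, hq, hTq, ?_⟩
    by_cases hc' : (S ∩ R q).card ≤ r
    · exact Or.inl hc'
    right
    obtain ⟨e, he, he1, he2⟩ := hBad S (S ∩ R q) Finset.inter_subset_left
      (Finset.inter_subset_right.trans Finset.sdiff_subset) hS (not_le.1 hc')
    have hTe : T e ⊆ S ∩ R q := by
      intro x hx
      simp only [T, Finset.mem_insert, Finset.mem_singleton] at hx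
      rcases hx with rfl | rfl <;> assumption
    exact ⟨e, Finset.mem_filter.2 ⟨he, hTe.trans Finset.inter_subset_right⟩, hTe⟩
  have hQ : ∀ q ∈ M, bprob p U (fun S => T q ⊆ S ∧ Q q (S ∩ R q)) ≤ p ^ 2 * (β + K) := by
    intro q hq
    obtain ⟨hqC, hq2⟩ := hT q hq
    rw [bprob_superset_and p (hqC.trans hC) (Finset.sdiff_subset.trans hC)
      Finset.disjoint_sdiff, hq2]
    gcongr
    refine (bprob_or_le h0 h1 _ _ _).trans (add_le_add (hβ _ Finset.sdiff_subset ?_) ?_)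
    · rw [Finset.card_sdiff_of_subset hqC, hq2]
      omega
    · refine (bprob_exists_le h0 h1 _ _ _).trans (le_trans ?_ hK)
      have : ∀ e ∈ M.filter (fun e => T e ⊆ R q), bprob p (R q) (fun S => T e ⊆ S) ≤ p ^ 2 := by
        intro e he
        obtain ⟨he, heR⟩ := Finset.mem_filter.1 he
        rw [bprob_superset_of_subset p heR, (hT e he).2]
      refine (Finset.sum_le_sum this).trans ?_
      rw [Finset.sum_const, nsmul_eq_mul]
      gcongr
      exact Finset.filter_subset _ _
  calc bprob p U Bad
      ≤ bprob p U (fun S => (S ∩ C).card ≤ r ∨ ∃ q ∈ M, T q ⊆ S ∧ Q q (S ∩ R q)) :=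
        bprob_mono h0 h1 fun S _ => incl S
    _ ≤ bprob p U (fun S => (S ∩ C).card ≤ r) +
          bprob p U (fun S => ∃ q ∈ M, T q ⊆ S ∧ Q q (S ∩ R q)) := bprob_or_le h0 h1 _ _ _
    _ ≤ β + ∑ q ∈ M, p ^ 2 * (β + K) := by
        refine add_le_add ?_ ((bprob_exists_le h0 h1 _ _ _).trans (Finset.sum_le_sum hQ))
        rw [bprob_inter p hC (fun S => S.card ≤ r)]
        exact hβ C subset_rfl (by omega)
    _ = β + (M.card * p ^ 2) * (β + K) := by
        rw [Finset.sum_const, nsmul_eq_mul]; ring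
    _ ≤ β + K * (β + K) := by gcongr

omit [DecidableEq α] in
/-- Second moment method. -/
lemma bprob_forall_not_le [Fintype V] {p a ε : ℝ} (h0 : 0 ≤ p) (h1 : p ≤ 1) {U : Finset α}
    {E : V → Finset α → Prop} (ha : 0 < a) (hV : 0 < Fintype.card V)
    (hE : ∀ v, bprob p U (E v) = a) (hε0 : 0 ≤ ε)
    (hε : ∀ v w, v ≠ w → bprob p U (fun S => E v S ∧ E w S) ≤ (1 + ε) * a ^ 2) :
    bprob p U (fun S => ∀ v, ¬ E v S) ≤ 1 / (Fintype.card V * a) + ε := by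
  classical
  set N : ℝ := (Fintype.card V : ℝ) with hN
  have hN0 : 0 < N := Nat.cast_pos.2 hV
  let I : V → Finset α → ℝ := fun v S => if E v S then 1 else 0
  have pt : ∀ S, (if ∀ v, ¬ E v S then (1 : ℝ) else 0) * (N * a) ^ 2 ≤
      (∑ v, ∑ w, I v S * I w S) + ((-2 * (N * a)) * (∑ v, I v S) + (N * a) ^ 2) := by
    intro S
    have e : (∑ v, ∑ w, I v S * I w S) + ((-2 * (N * a)) * (∑ v, I v S) + (N * a) ^ 2) =
        ((∑ v, I v S) - N * a) ^ 2 := by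
      rw [← Finset.sum_mul_sum]; ring
    rw [e]
    split_ifs with h
    · have : ∑ v, I v S = 0 := Finset.sum_eq_zero fun v _ => by simp [I, h v]
      rw [this]; apply le_of_eq; ring
    · rw [zero_mul]; positivity
  have pair : ∀ v w, bmean p U (fun S => I v S * I w S) ≤
      (if v = w then a else 0) + (1 + ε) * a ^ 2 := by
    intro v w
    have e : bmean p U (fun S => I v S * I w S) = bprob p U (fun S => E v S ∧ E w S) :=
      bmean_congr p fun S _ => by
        by_cases h : E v S <;> by_cases h' : E w S <;> simp [I, h, h']
    rw [e]
    split_ifs with h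
    · subst h
      simp only [and_self, hE]
      have : 0 ≤ (1 + ε) * a ^ 2 := by positivity
      linarith
    · simpa using hε v w h
  have main : bprob p U (fun S => ∀ v, ¬ E v S) * (N * a) ^ 2 ≤
      N * a + ε * (N * a) ^ 2 := by
    have h2 : bprob p U (fun S => ∀ v, ¬ E v S) * (N * a) ^ 2 ≤
        bmean p U (fun S => (∑ v, ∑ w, I v S * I w S) +
          ((-2 * (N * a)) * (∑ v, I v S) + (N * a) ^ 2)) := by
      unfold bprob
      rw [← bmean_mul_right]
      exact bmean_mono h0 h1 fun S _ => by convert pt S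
    rw [bmean_add, bmean_add, bmean_const, bmean_mul_left, bmean_sum, bmean_sum] at h2
    have e1 : ∑ v, bmean p U (I v) = N * a := by
      rw [Finset.sum_congr rfl fun v _ => show bmean p U (I v) = a from hE v]
      simp [hN]
    have e2 : ∑ v, bmean p U (fun S => ∑ w, I v S * I w S) ≤
        N * a + (N * N) * ((1 + ε) * a ^ 2) := by
      calc _ ≤ ∑ v : V, ∑ w : V, ((if v = w then a else 0) + (1 + ε) * a ^ 2) := by
            refine Finset.sum_le_sum fun v _ => ?_
            rw [bmean_sum]
            exact Finset.sum_le_sum fun w _ => pair v w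
        _ = _ := by
            simp only [Finset.sum_add_distrib, Finset.sum_ite_eq, Finset.mem_univ, if_true,
              Finset.sum_const, Finset.card_univ, nsmul_eq_mul, ← hN]
            ring
    rw [e1] at h2
    nlinarith
  have hpos : 0 < N * a := by positivity
  have : bprob p U (fun S => ∀ v, ¬ E v S) ≤ (N * a + ε * (N * a) ^ 2) / (N * a) ^ 2 := by
    rwa [le_div_iff₀ (by positivity)]
  refine this.trans (le_of_eq ?_)
  field_simp

/-- Two-point estimate for the events that exactly `r` members of a family are selected, all of
them from a subfamily. -/
lemma bprob_pair_le {p a B : ℝ} (h0 : 0 ≤ p) (h1 : p < 1) {r m g μ : ℕ}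
    {U C C' G G' : Finset α} (hC : C ⊆ U) (hC' : C' ⊆ U) (hG : G ⊆ C) (hG' : G' ⊆ C')
    (hm : C.card = m) (hm' : C'.card = m) (hg : G.card = g) (hg' : G'.card = g)
    (hμ : (C ∩ C').card = μ) (ha : a = (g.choose r : ℝ) * (p ^ r * (1 - p) ^ (m - r)))
    (hB : ∀ A : Finset α, A.card + μ = m → bprob p A (fun S => S.card ≤ r) ≤ B * a) :
    bprob p U (fun S => (S ∩ C ⊆ G ∧ (S ∩ C).card = r) ∧ (S ∩ C' ⊆ G' ∧ (S ∩ C').card = r)) ≤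
      (((1 - p) ^ μ)⁻¹ ^ 2 + μ * p * B ^ 2) * a ^ 2 := by
  classical
  have hq : 0 < 1 - p := sub_pos.2 h1
  have single : ∀ C₁ C₂ G₁ : Finset α, G₁ ⊆ C₁ → C₁.card = m → G₁.card = g →
      (C₁ ∩ C₂).card = μ → (C₁ \ C₂).card + μ = m ∧
      bprob p (C₁ \ C₂) (fun S => S ⊆ G₁ \ C₂ ∧ S.card = r) ≤ ((1 - p) ^ μ)⁻¹ * a := by
    intro C₁ C₂ G₁ hG₁ hm₁ hg₁ hμ₁
    have hc : (C₁ \ C₂).card + μ = m := by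
      rw [← hμ₁, ← hm₁, Finset.card_sdiff_add_card_inter]
    refine ⟨hc, ?_⟩
    rw [bprob_subset_card_eq p (Finset.sdiff_subset_sdiff hG₁ subset_rfl), inv_mul_eq_div,
      le_div_iff₀ (pow_pos hq _), ha, mul_assoc, mul_assoc, ← pow_add]
    gcongr ?_ * (_ * ?_)
    · exact_mod_cast Nat.choose_le_choose r (hg₁ ▸ Finset.card_le_card Finset.sdiff_subset)
    · exact pow_le_pow_of_le_one hq.le (by linarith) (by omega)
  obtain ⟨c1, s1⟩ := single C C' G hG hm hg hμ
  obtain ⟨c2, s2⟩ := single C' C G' hG' hm' hg' (by rw [Finset.inter_comm, hμ])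
  have hd : Disjoint (C \ C') (C' \ C) :=
    Finset.disjoint_sdiff.mono_left Finset.sdiff_subset |>.symm
  have s1U : C \ C' ⊆ U := Finset.sdiff_subset.trans hC
  have s2U : C' \ C ⊆ U := Finset.sdiff_subset.trans hC'
  have incl : ∀ S, ((S ∩ C ⊆ G ∧ (S ∩ C).card = r) ∧ (S ∩ C' ⊆ G' ∧ (S ∩ C').card = r)) →
      ((S ∩ (C \ C') ⊆ G \ C' ∧ (S ∩ (C \ C')).card = r) ∧
        (S ∩ (C' \ C) ⊆ G' \ C ∧ (S ∩ (C' \ C)).card = r)) ∨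
      ∃ c ∈ C ∩ C', {c} ⊆ S ∧ ((S ∩ (C \ C' ∪ C' \ C) ∩ (C \ C')).card ≤ r ∧
        (S ∩ (C \ C' ∪ C' \ C) ∩ (C' \ C)).card ≤ r) := by
    rintro S ⟨⟨k1, k2⟩, k3, k4⟩
    by_cases h : ∃ c ∈ C ∩ C', c ∈ S
    · right
      obtain ⟨c, hc, hcS⟩ := h
      refine ⟨c, hc, by simpa using hcS, ?_, ?_⟩
      · rw [← k2]
        exact Finset.card_le_card fun x hx => by
          simp only [Finset.mem_inter, Finset.mem_union, Finset.mem_sdiff] at hx ⊢; tauto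
      · rw [← k4]
        exact Finset.card_le_card fun x hx => by
          simp only [Finset.mem_inter, Finset.mem_union, Finset.mem_sdiff] at hx ⊢; tauto
    · left
      push Not at h
      have e1 : S ∩ (C \ C') = S ∩ C := by
        ext x
        have := h x
        simp only [Finset.mem_inter, Finset.mem_sdiff] at *
        tauto
      have e2 : S ∩ (C' \ C) = S ∩ C' := by
        ext x
        have := h x
        simp only [Finset.mem_inter, Finset.mem_sdiff] at *
        tauto
      rw [e1, e2]
      refine ⟨⟨fun x hx => ?_, k2⟩, fun x hx => ?_, k4⟩
      · have h1 := k1 hx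
        rw [← e1] at hx
        exact Finset.mem_sdiff.2 ⟨h1, (Finset.mem_sdiff.1 (Finset.mem_inter.1 hx).2).2⟩
      · have h1 := k3 hx
        rw [← e2] at hx
        exact Finset.mem_sdiff.2 ⟨h1, (Finset.mem_sdiff.1 (Finset.mem_inter.1 hx).2).2⟩
  have hBa : 0 ≤ B * a := (bprob_nonneg h0 h1.le _ _).trans (hB _ c1)
  have t1 : bprob p U (fun S => (S ∩ (C \ C') ⊆ G \ C' ∧ (S ∩ (C \ C')).card = r) ∧
        (S ∩ (C' \ C) ⊆ G' \ C ∧ (S ∩ (C' \ C)).card = r)) ≤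
        (((1 - p) ^ μ)⁻¹ * a) * (((1 - p) ^ μ)⁻¹ * a) := by
    rw [bprob_inter_and p s1U s2U hd (fun S => S ⊆ G \ C' ∧ S.card = r)
      (fun S => S ⊆ G' \ C ∧ S.card = r)]
    exact mul_le_mul s1 s2 (bprob_nonneg h0 h1.le _ _)
      ((bprob_nonneg h0 h1.le _ _).trans s1)
  have t2 : ∀ c ∈ C ∩ C', bprob p U (fun S => {c} ⊆ S ∧
      ((S ∩ (C \ C' ∪ C' \ C) ∩ (C \ C')).card ≤ r ∧
        (S ∩ (C \ C' ∪ C' \ C) ∩ (C' \ C)).card ≤ r)) ≤ p * ((B * a) * (B * a)) := by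
    intro c hc
    obtain ⟨hc1, hc2⟩ := Finset.mem_inter.1 hc
    rw [bprob_superset_and p (T := {c}) (by simpa using hC hc1) (Finset.union_subset s1U s2U)
      (by simp [hc1, hc2])
      (fun S => (S ∩ (C \ C')).card ≤ r ∧ (S ∩ (C' \ C)).card ≤ r),
      bprob_inter_and p Finset.subset_union_left Finset.subset_union_right hd
        (fun S => S.card ≤ r) (fun S => S.card ≤ r), Finset.card_singleton, pow_one]
    gcongr
    · exact bprob_nonneg h0 h1.le _ _
    · exact hB _ c1
    · exact hB _ c2
  refine (bprob_mono h0 h1.le fun S _ => incl S).trans ((bprob_or_le h0 h1.le _ _ _).trans ?_)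
  refine (add_le_add t1 ((bprob_exists_le h0 h1.le _ _ _).trans
    (Finset.sum_le_sum t2))).trans (le_of_eq ?_)
  rw [Finset.sum_const, hμ, nsmul_eq_mul]
  ring

end RandomSubsetEvents

section Copies

open Classical

variable {k n : ℕ} {H : SimpleGraph (Fin k)}

/-- The copies of `H` whose vertex set contains `v`. -/
noncomputable def copiesAt (H : SimpleGraph (Fin k)) (v : Fin n) : Finset (Copy H n) :=
  Finset.univ.filter (fun c => v ∈ c.1.support)

/-- The copies of `H` in which `v` is a vertex of minimum degree. -/
noncomputable def minCopiesAt (H : SimpleGraph (Fin k)) (v : Fin n) : Finset (Copy H n) :=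
  Finset.univ.filter (fun c => v ∈ c.1.support ∧ (c.1.neighborSet v).ncard = minDeg H)

lemma mem_copiesAt {v : Fin n} {c : Copy H n} : c ∈ copiesAt H v ↔ v ∈ c.1.support := by
  simp [copiesAt]

lemma mem_minCopiesAt {v : Fin n} {c : Copy H n} :
    c ∈ minCopiesAt H v ↔ v ∈ c.1.support ∧ (c.1.neighborSet v).ncard = minDeg H := by
  simp [minCopiesAt]

lemma minCopiesAt_subset (v : Fin n) : minCopiesAt H v ⊆ copiesAt H v :=
  fun _ hc => mem_copiesAt.2 (mem_minCopiesAt.1 hc).1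

/-- The action of vertex permutations on copies. -/
def permCopy (σ : Equiv.Perm (Fin n)) (c : Copy H n) : Copy H n :=
  ⟨c.1.map σ.toEmbedding, by
    obtain ⟨f, hf⟩ := c.2
    exact ⟨f.trans σ.toEmbedding, by rw [hf, SimpleGraph.map_map]; rfl⟩⟩

lemma permCopy_injective (σ : Equiv.Perm (Fin n)) :
    Function.Injective (permCopy σ : Copy H n → Copy H n) := fun _ _ h =>
  Subtype.ext (SimpleGraph.map_injective σ.toEmbedding (congrArg Subtype.val h))

lemma mem_support_permCopy {σ : Equiv.Perm (Fin n)} {c : Copy H n} {v : Fin n}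
    (h : v ∈ c.1.support) : σ v ∈ (permCopy σ c).1.support := by
  have := SimpleGraph.support_map σ.toEmbedding c.1
  change _ ∈ (c.1.map σ.toEmbedding).support
  rw [this]
  exact ⟨v, h, rfl⟩

lemma ncard_neighborSet_permCopy (σ : Equiv.Perm (Fin n)) (c : Copy H n) (v : Fin n) :
    ((permCopy σ c).1.neighborSet (σ v)).ncard = (c.1.neighborSet v).ncard := by
  have := SimpleGraph.neighborSet_map c.1 σ.toEmbedding v
  change ((c.1.map σ.toEmbedding).neighborSet (σ.toEmbedding v)).ncard = _
  rw [this]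
  exact Set.ncard_image_of_injective _ σ.toEmbedding.injective

lemma card_le_card_of_permCopy (σ : Equiv.Perm (Fin n)) {s t : Finset (Copy H n)}
    (h : ∀ c ∈ s, permCopy σ c ∈ t) : s.card ≤ t.card :=
  Finset.card_le_card_of_injOn (permCopy σ) h (permCopy_injective σ).injOn

lemma card_copiesAt_eq (v w : Fin n) : (copiesAt H v).card = (copiesAt H w).card := by
  have key : ∀ v w : Fin n, (copiesAt H v).card ≤ (copiesAt H w).card := fun v w =>
    card_le_card_of_permCopy (Equiv.swap v w) fun c hc => by
      rw [mem_copiesAt] at hc ⊢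
      simpa using mem_support_permCopy (σ := Equiv.swap v w) hc
  exact le_antisymm (key v w) (key w v)

lemma card_minCopiesAt_eq (v w : Fin n) :
    (minCopiesAt H v).card = (minCopiesAt H w).card := by
  have key : ∀ v w : Fin n, (minCopiesAt H v).card ≤ (minCopiesAt H w).card := fun v w =>
    card_le_card_of_permCopy (Equiv.swap v w) fun c hc => by
      rw [mem_minCopiesAt] at hc ⊢
      have h1 := mem_support_permCopy (σ := Equiv.swap v w) hc.1
      have h2 := ncard_neighborSet_permCopy (Equiv.swap v w) c v
      rw [Equiv.swap_apply_left] at h1 h2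
      exact ⟨h1, h2.trans hc.2⟩
  exact le_antisymm (key v w) (key w v)

lemma card_copiesAt_inter_eq {v w w' : Fin n} (h : v ≠ w) (h' : v ≠ w') :
    (copiesAt H v ∩ copiesAt H w).card = (copiesAt H v ∩ copiesAt H w').card := by
  have key : ∀ w w' : Fin n, v ≠ w → v ≠ w' →
      (copiesAt H v ∩ copiesAt H w).card ≤ (copiesAt H v ∩ copiesAt H w').card :=
    fun w w' h h' => card_le_card_of_permCopy (Equiv.swap w w') fun c hc => by
      simp only [Finset.mem_inter, mem_copiesAt] at hc ⊢
      have h1 := mem_support_permCopy (σ := Equiv.swap w w') hc.1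
      have h2 := mem_support_permCopy (σ := Equiv.swap w w') hc.2
      rw [Equiv.swap_apply_of_ne_of_ne h h'] at h1
      rw [Equiv.swap_apply_left] at h2
      exact ⟨h1, h2⟩
  exact le_antisymm (key w w' h h') (key w' w h' h)

lemma mr_one_eq_card (v : Fin n) : mr H n 1 = (copiesAt H v).card := by
  have hn : 0 < n := v.pos
  rw [card_copiesAt_eq v ⟨0, hn⟩]
  unfold mr
  have e : {G : SimpleGraph (Fin n) // IsCopy H G ∧ ∃ v ∈ G.support, (v : ℕ) < 1} ≃
      {c : Copy H n // c ∈ copiesAt H (⟨0, hn⟩ : Fin n)} :=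
    { toFun := fun G => ⟨⟨G.1, G.2.1⟩, by
        obtain ⟨v, hv, hv0⟩ := G.2.2
        have : v = ⟨0, hn⟩ := Fin.ext (by simpa using hv0)
        rw [mem_copiesAt]
        exact this ▸ hv⟩
      invFun := fun c => ⟨c.1.1, c.1.2, ⟨0, hn⟩, mem_copiesAt.1 c.2, Nat.one_pos⟩
      left_inv := fun _ => rfl
      right_inv := fun _ => rfl }
  rw [Nat.card_congr e, Nat.card_eq_fintype_card, Fintype.card_coe]

lemma support_eq_univ (hiso : ∀ v, (H.neighborSet v).Nonempty) : H.support = Set.univ :=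
  Set.eq_univ_of_forall fun v => (hiso v).imp fun _ h => h

lemma card_support (hiso : ∀ v, (H.neighborSet v).Nonempty) (c : Copy H n) :
    (Finset.univ.filter (fun v => c ∈ copiesAt H v)).card = k := by
  obtain ⟨f, hf⟩ := c.2
  have : Finset.univ.filter (fun v => c ∈ copiesAt H v) = Finset.univ.map f := by
    ext v
    simp only [Finset.mem_filter, Finset.mem_univ, true_and, mem_copiesAt, hf,
      SimpleGraph.support_map, support_eq_univ hiso, Finset.mem_map, Set.image_univ,
      Set.mem_range]
  rw [this]
  simp

lemma minDeg_le_ncard (v : Fin k) : minDeg H ≤ (H.neighborSet v).ncard :=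
  ciInf_le (OrderBot.bddBelow _) v

lemma exists_ncard_eq_minDeg (hk : 0 < k) : ∃ v, (H.neighborSet v).ncard = minDeg H := by
  have : Nonempty (Fin k) := ⟨⟨0, hk⟩⟩
  exact Nat.sInf_mem (Set.range_nonempty fun v => (H.neighborSet v).ncard)

lemma minDeg_pos (hk : 0 < k) (hiso : ∀ v, (H.neighborSet v).Nonempty) : 0 < minDeg H := by
  obtain ⟨v, hv⟩ := exists_ncard_eq_minDeg (H := H) hk
  rw [← hv]
  exact (hiso v).ncard_pos

lemma two_le_of_neighborSet_nonempty (hk : 0 < k) (hiso : ∀ v, (H.neighborSet v).Nonempty) :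
    2 ≤ k := by
  obtain ⟨w, hw⟩ := hiso ⟨0, hk⟩
  have := H.ne_of_adj hw
  by_contra h
  exact this (Fin.ext (by have := w.2; simp; omega))

lemma minDeg_le_of_mem_copiesAt {v : Fin n} {c : Copy H n} (h : c ∈ copiesAt H v) :
    minDeg H ≤ (c.1.neighborSet v).ncard := by
  obtain ⟨f, hf⟩ := c.2
  rw [mem_copiesAt, hf, SimpleGraph.support_map] at h
  obtain ⟨u, -, rfl⟩ := h
  rw [hf, SimpleGraph.neighborSet_map, Set.ncard_image_of_injective _ f.injective]
  exact minDeg_le_ncard u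

lemma card_copiesAt_inter_mul (hiso : ∀ v, (H.neighborSet v).Nonempty) {v w : Fin n}
    (h : v ≠ w) :
    (copiesAt H v ∩ copiesAt H w).card * (n - 1) = (copiesAt H v).card * (k - 1) := by
  have e := Finset.sum_card_bipartiteAbove_eq_sum_card_bipartiteBelow
    (s := Finset.univ.erase v) (t := copiesAt H v) (fun (w : Fin n) c => c ∈ copiesAt H w)
  rw [Finset.sum_congr rfl (g := fun _ => (copiesAt H v ∩ copiesAt H w).card),
    Finset.sum_congr rfl (s₁ := copiesAt H v) (g := fun _ => k - 1)] at e
  · rw [Finset.sum_const, Finset.sum_const, Finset.card_erase_of_mem (Finset.mem_univ v),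
      Finset.card_univ, Fintype.card_fin, smul_eq_mul, smul_eq_mul] at e
    rw [mul_comm, e]
  · intro c hc
    have hs := card_support hiso c
    have he := Finset.card_erase_of_mem (s := Finset.univ.filter (fun v => c ∈ copiesAt H v))
      (a := v) (by simpa using hc)
    rw [hs] at he
    rw [← he]
    congr 1
    ext x
    simp [Finset.bipartiteBelow]
  · intro u hu
    rw [card_copiesAt_inter_eq h (Finset.ne_of_mem_erase hu).symm]
    congr 1

lemma card_copiesAt_le (hk : 0 < k) (hiso : ∀ v, (H.neighborSet v).Nonempty) (v : Fin n) :
    (copiesAt H v).card ≤ k * (minCopiesAt H v).card := by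
  have hn : 0 < n := v.pos
  have e := Finset.sum_card_bipartiteAbove_eq_sum_card_bipartiteBelow
    (s := (Finset.univ : Finset (Fin n))) (t := (Finset.univ : Finset (Copy H n)))
    (fun w c => c ∈ copiesAt H w)
  have e' := Finset.sum_card_bipartiteAbove_eq_sum_card_bipartiteBelow
    (s := (Finset.univ : Finset (Fin n))) (t := (Finset.univ : Finset (Copy H n)))
    (fun w c => c ∈ minCopiesAt H w)
  rw [Finset.sum_congr rfl (g := fun _ => (copiesAt H v).card),
    Finset.sum_congr rfl (s₁ := (Finset.univ : Finset (Copy H n))) (g := fun _ => k)] at e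
  rotate_left
  · exact fun c _ => card_support hiso c
  · intro u _
    rw [card_copiesAt_eq v u]
    congr 1
    ext c
    simp [Finset.bipartiteAbove]
  rw [Finset.sum_congr rfl (g := fun _ => (minCopiesAt H v).card)] at e'
  swap
  · intro u _
    rw [card_minCopiesAt_eq v u]
    congr 1
    ext c
    simp [Finset.bipartiteAbove]
  have lb : (Finset.univ : Finset (Copy H n)).card * 1 ≤ n * (minCopiesAt H v).card := by
    rw [Finset.sum_const, Finset.card_univ, Fintype.card_fin, smul_eq_mul] at e'
    rw [e', ← smul_eq_mul]
    refine Finset.card_nsmul_le_sum _ _ _ fun c _ => Finset.card_pos.2 ?_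
    obtain ⟨f, hf⟩ := c.2
    obtain ⟨u, hu⟩ := exists_ncard_eq_minDeg (H := H) hk
    refine ⟨f u, ?_⟩
    simp only [Finset.mem_bipartiteBelow, Finset.mem_univ, true_and, mem_minCopiesAt]
    rw [hf, SimpleGraph.support_map, support_eq_univ hiso, SimpleGraph.neighborSet_map,
      Set.ncard_image_of_injective _ f.injective]
    exact ⟨⟨u, trivial, rfl⟩, hu⟩
  rw [Finset.sum_const, Finset.sum_const, Finset.card_univ, Fintype.card_fin, smul_eq_mul,
    smul_eq_mul] at e
  refine Nat.le_of_mul_le_mul_left ?_ hn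
  calc n * (copiesAt H v).card = (Finset.univ : Finset (Copy H n)).card * k := e
    _ ≤ n * (minCopiesAt H v).card * k := by gcongr; simpa using lb
    _ = n * (k * (minCopiesAt H v).card) := by ring

lemma copiesAt_card_pos (hk : 0 < k) (hiso : ∀ v, (H.neighborSet v).Nonempty) (hkn : k ≤ n)
    (v : Fin n) : 0 < (copiesAt H v).card := by
  let f : Fin k ↪ Fin n := Fin.castLEEmb hkn
  rw [card_copiesAt_eq v (f ⟨0, hk⟩)]
  refine Finset.card_pos.2 ⟨⟨H.map f, f, rfl⟩, ?_⟩
  rw [mem_copiesAt, SimpleGraph.support_map, support_eq_univ hiso]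
  exact ⟨_, trivial, rfl⟩

lemma sub_one_le_card_mul (hk : 0 < k) (hiso : ∀ v, (H.neighborSet v).Nonempty) (hkn : k ≤ n)
    (v : Fin n) : n - 1 ≤ (copiesAt H v).card * (k - 1) := by
  have hk2 := two_le_of_neighborSet_nonempty hk hiso
  have : Nontrivial (Fin n) := Fin.nontrivial_iff_two_le.2 (hk2.trans hkn)
  obtain ⟨w, hw⟩ := exists_ne v
  have e := card_copiesAt_inter_mul hiso hw.symm
  have pos : 0 < (copiesAt H v ∩ copiesAt H w).card := by
    by_contra h
    have h0 : (copiesAt H v ∩ copiesAt H w).card = 0 := by omega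
    rw [h0, zero_mul] at e
    have := copiesAt_card_pos hk hiso hkn v
    have : 0 < (copiesAt H v).card * (k - 1) := Nat.mul_pos this (by omega)
    omega
  rw [← e]
  exact Nat.le_mul_of_pos_left _ pos

/-- The graph spanned by the copies in `S`. -/
noncomputable def graphOfSet (S : Finset (Copy H n)) : SimpleGraph (Fin n) :=
  graphOf (fun c => decide (c ∈ S))

lemma graphOfSet_adj {S : Finset (Copy H n)} {u v : Fin n} :
    (graphOfSet S).Adj u v ↔ ∃ c ∈ S, c.1.Adj u v := by
  simp only [graphOfSet, graphOf, SimpleGraph.iSup_adj, decide_eq_true_eq]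
  refine exists_congr fun c => ?_
  by_cases h : c ∈ S <;> simp [h]

lemma motifProb_eq_bprob (H : SimpleGraph (Fin k)) (n : ℕ) (p : ℝ)
    (Q : SimpleGraph (Fin n) → Prop) :
    motifProb H n p Q = bprob p (Finset.univ : Finset (Copy H n)) (fun S => Q (graphOfSet S)) := by
  unfold motifProb selProb bprob graphOfSet
  rw [← sum_prod_bool_eq_bmean p (fun ω => if Q (graphOf ω) then 1 else 0)]

/-- Ordered pairs of distinct copies through `v` that share a further vertex. -/
noncomputable def overlapPairs (H : SimpleGraph (Fin k)) (v : Fin n) :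
    Finset (Copy H n × Copy H n) :=
  ((Finset.univ.erase v).biUnion fun u =>
    (copiesAt H v ∩ copiesAt H u) ×ˢ (copiesAt H v ∩ copiesAt H u)).filter
      (fun q => q.1 ≠ q.2)

lemma card_overlapPairs_le {v w : Fin n} (h : v ≠ w) :
    (overlapPairs H v).card ≤ (n - 1) * (copiesAt H v ∩ copiesAt H w).card ^ 2 := by
  refine (Finset.card_filter_le _ _).trans (Finset.card_biUnion_le.trans ?_)
  have : ∀ u ∈ (Finset.univ : Finset (Fin n)).erase v,
      ((copiesAt H v ∩ copiesAt H u) ×ˢ (copiesAt H v ∩ copiesAt H u)).card =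
        (copiesAt H v ∩ copiesAt H w).card ^ 2 := fun u hu => by
    rw [Finset.card_product, card_copiesAt_inter_eq h (Finset.ne_of_mem_erase hu).symm, sq]
  rw [Finset.sum_congr rfl this, Finset.sum_const,
    Finset.card_erase_of_mem (Finset.mem_univ v), Finset.card_univ, Fintype.card_fin,
    smul_eq_mul]

lemma exists_overlapPairs {d r : ℕ} (hdr : d ≤ (r + 1) * minDeg H) {v : Fin n}
    {S W : Finset (Copy H n)} (hWS : W ⊆ S) (hWC : W ⊆ copiesAt H v)
    (hdeg : ((graphOfSet S).neighborSet v).ncard < d) (hW : r < W.card) :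
    ∃ q ∈ overlapPairs H v, q.1 ∈ W ∧ q.2 ∈ W := by
  by_contra hcon
  have disj : (W : Set (Copy H n)).PairwiseDisjoint
      (fun c => Finset.univ.filter (fun u => c.1.Adj v u)) := by
    intro c hc c' hc' hne
    rw [Function.onFun, Finset.disjoint_left]
    intro u hu hu'
    simp only [Finset.mem_filter, Finset.mem_univ, true_and] at hu hu'
    refine hcon ⟨(c, c'), ?_, hc, hc'⟩
    refine Finset.mem_filter.2 ⟨Finset.mem_biUnion.2 ⟨u, ?_, ?_⟩, hne⟩
    · simpa using (c.1.ne_of_adj hu).symm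
    · simp only [Finset.mem_product, Finset.mem_inter, mem_copiesAt]
      exact ⟨⟨⟨u, hu⟩, ⟨v, hu.symm⟩⟩, ⟨⟨u, hu'⟩, ⟨v, hu'.symm⟩⟩⟩
  have card_nbr : ∀ c : Copy H n, (Finset.univ.filter (fun u => c.1.Adj v u)).card =
      (c.1.neighborSet v).ncard := fun c => by
    rw [← Set.ncard_coe_finset]
    congr 1
    ext u
    simp
  have : (r + 1) * minDeg H ≤ ((graphOfSet S).neighborSet v).ncard := by
    calc (r + 1) * minDeg H ≤ W.card * minDeg H := by gcongr; omega
      _ ≤ ∑ c ∈ W, (Finset.univ.filter (fun u => c.1.Adj v u)).card := by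
          rw [← smul_eq_mul]
          refine Finset.card_nsmul_le_sum _ _ _ fun c hc => ?_
          rw [card_nbr]
          exact minDeg_le_of_mem_copiesAt (hWC hc)
      _ = (W.biUnion fun c => Finset.univ.filter (fun u => c.1.Adj v u)).card :=
          (Finset.card_biUnion disj).symm
      _ ≤ ((graphOfSet S).neighborSet v).ncard := by
          rw [← Set.ncard_coe_finset]
          refine Set.ncard_le_ncard (fun u hu => ?_) (Set.toFinite _)
          simp only [Finset.coe_biUnion, Finset.mem_coe, Set.mem_iUnion, Finset.mem_filter,
            Finset.mem_univ, true_and, exists_prop] at hu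
          obtain ⟨c, hc, hu⟩ := hu
          exact graphOfSet_adj.2 ⟨c, hWS hc, hu⟩
  omega

lemma ncard_neighborSet_graphOfSet_le {v : Fin n} {S : Finset (Copy H n)}
    (h : S ∩ copiesAt H v ⊆ minCopiesAt H v) :
    ((graphOfSet S).neighborSet v).ncard ≤ (S ∩ copiesAt H v).card * minDeg H := by
  have e : (graphOfSet S).neighborSet v =
      ⋃ c ∈ S ∩ copiesAt H v, c.1.neighborSet v := by
    ext u
    simp only [SimpleGraph.mem_neighborSet, graphOfSet_adj, Set.mem_iUnion, exists_prop,
      Finset.mem_inter, mem_copiesAt]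
    exact exists_congr fun c => ⟨fun hc => ⟨⟨hc.1, u, hc.2⟩, hc.2⟩, fun hc => ⟨hc.1.1, hc.2⟩⟩
  rw [e]
  refine (Finset.set_ncard_biUnion_le _ _).trans ?_
  rw [← smul_eq_mul]
  exact Finset.sum_le_card_nsmul _ _ _ fun c hc => (mem_minCopiesAt.1 (h hc)).2.le

lemma deltad_bounds (hk : 0 < k) (hiso : ∀ v, (H.neighborSet v).Nonempty) {d : ℕ}
    (hd : 1 ≤ d) :
    deltad H d * minDeg H < d ∧ d ≤ (deltad H d + 1) * minDeg H := by
  have hδ : (0 : ℝ) < minDeg H := by exact_mod_cast minDeg_pos hk hiso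
  have hd' : (0 : ℝ) < d := by exact_mod_cast hd
  have hc : 0 < ⌈(d : ℝ) / (minDeg H : ℝ)⌉₊ := Nat.ceil_pos.2 (div_pos hd' hδ)
  have e : deltad H d + 1 = ⌈(d : ℝ) / (minDeg H : ℝ)⌉₊ := by unfold deltad; omega
  constructor
  · have : deltad H d < ⌈(d : ℝ) / (minDeg H : ℝ)⌉₊ := by omega
    rw [Nat.lt_ceil, lt_div_iff₀ hδ] at this
    exact_mod_cast this
  · rw [e]
    have := Nat.le_ceil ((d : ℝ) / (minDeg H : ℝ))
    rw [div_le_iff₀ hδ] at this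
    exact_mod_cast this

end Copies

section Finite

variable {k n : ℕ} {H : SimpleGraph (Fin k)}

lemma card_inter_mul_p {p L : ℝ} {m μ : ℕ} (hk : 2 ≤ k) (hn : 2 ≤ n)
    (hμ : μ * (n - 1) = m * (k - 1)) (hL : L = m * p) (hL0 : 0 ≤ L) :
    μ * p ≤ k * L / (n - 1) := by
  have hn' : (0 : ℝ) < n - 1 := by
    have : (2 : ℝ) ≤ n := by exact_mod_cast hn
    linarith
  have e : (μ : ℝ) * (n - 1) = m * (k - 1) := by
    have := congrArg (Nat.cast (R := ℝ)) hμ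
    rw [Nat.cast_mul, Nat.cast_mul, Nat.cast_sub (by omega), Nat.cast_sub (by omega)] at this
    simpa using this
  rw [le_div_iff₀ hn']
  calc (μ : ℝ) * p * (n - 1) = (μ * (n - 1)) * p := by ring
    _ = (k - 1) * L := by rw [e, hL]; ring
    _ ≤ k * L := by gcongr; linarith

/-- Explicit bound for the failure probability above the threshold. -/
lemma motifProb_not_forall_le (hk : 0 < k) (hiso : ∀ v, (H.neighborSet v).Nonempty) {d r : ℕ}
    (hdr : d ≤ (r + 1) * minDeg H) (hn : 2 ≤ n) {p L : ℝ} (h0 : 0 ≤ p) (h1 : p ≤ 1)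
    (hL : L = mr H n 1 * p) (hL1 : 1 ≤ L) :
    motifProb H n p (fun G => ¬ ∀ v : Fin n, d ≤ (G.neighborSet v).ncard) ≤
      n * ((r + 1) * L ^ r * Real.exp ((2 + r) - L) + (k * L) ^ 2 / (n - 1) *
        ((r + 1) * L ^ r * Real.exp ((2 + r) - L) + (k * L) ^ 2 / (n - 1))) := by
  classical
  have hk2 := two_le_of_neighborSet_nonempty hk hiso
  have : Nontrivial (Fin n) := Fin.nontrivial_iff_two_le.2 hn
  have hn' : (0 : ℝ) < n - 1 := by
    have : (2 : ℝ) ≤ n := by exact_mod_cast hn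
    linarith
  rw [motifProb_eq_bprob]
  have e : bprob p (Finset.univ : Finset (Copy H n))
      (fun S => ¬ ∀ v : Fin n, d ≤ ((graphOfSet S).neighborSet v).ncard) ≤
      ∑ v : Fin n, bprob p (Finset.univ : Finset (Copy H n))
        (fun S => ((graphOfSet S).neighborSet v).ncard < d) := by
    refine le_trans (bprob_mono h0 h1 fun S _ hS => ?_) (bprob_exists_le h0 h1 _ _ _)
    push Not at hS
    simpa using hS
  refine e.trans ((Finset.sum_le_card_nsmul Finset.univ _
    ((r + 1) * L ^ r * Real.exp ((2 + r) - L) + (k * L) ^ 2 / (n - 1) *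
      ((r + 1) * L ^ r * Real.exp ((2 + r) - L) + (k * L) ^ 2 / (n - 1))) fun v _ => ?_).trans
    (by rw [Finset.card_univ, Fintype.card_fin, nsmul_eq_mul]))
  refine bprob_le_of_overlap h0 h1 (Finset.subset_univ (copiesAt H v)) (M := overlapPairs H v)
    (r := r) ?_ (fun S W hWS hWC hS hW => exists_overlapPairs hdr hWS hWC hS hW) ?_ ?_
  · intro q hq
    obtain ⟨hq, hne⟩ := Finset.mem_filter.1 hq
    obtain ⟨u, -, hu⟩ := Finset.mem_biUnion.1 hq
    obtain ⟨h1, h2⟩ := Finset.mem_product.1 hu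
    exact ⟨(Finset.mem_inter.1 h1).1, (Finset.mem_inter.1 h2).1, hne⟩
  · intro A hA hcard
    rw [mr_one_eq_card v] at hL
    refine bprob_card_le_le (s := 2) h0 h1 (Finset.card_le_card hA) hcard hL hL1 ?_
    push_cast
    have : (0 : ℝ) ≤ 2 + r := by positivity
    nlinarith
  · obtain ⟨w, hw⟩ := exists_ne v
    rw [mr_one_eq_card v] at hL
    have hμ := card_inter_mul_p hk2 hn (card_copiesAt_inter_mul hiso hw.symm) hL (by linarith)
    set μ := (copiesAt H v ∩ copiesAt H w).card
    have c1 : ((overlapPairs H v).card : ℝ) ≤ (n - 1) * (μ : ℝ) ^ 2 := by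
      have := card_overlapPairs_le (H := H) hw.symm
      have := (Nat.cast_le (α := ℝ)).2 this
      rw [Nat.cast_mul, Nat.cast_sub (by omega), Nat.cast_pow] at this
      simpa using this
    calc ((overlapPairs H v).card : ℝ) * p ^ 2 ≤ (n - 1) * (μ : ℝ) ^ 2 * p ^ 2 := by gcongr
      _ = (n - 1) * (μ * p) ^ 2 := by ring
      _ ≤ (n - 1) * (k * L / (n - 1)) ^ 2 := by gcongr
      _ = (k * L) ^ 2 / (n - 1) := by field_simp

lemma exp_neg_le_one_sub_pow {p : ℝ} (h1 : p ≤ 1 / 2) (m : ℕ) :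
    Real.exp (-(m * (p + 2 * p ^ 2))) ≤ (1 - p) ^ m := by
  have hq : 0 < 1 - p := by linarith
  have key : Real.exp (-(p + 2 * p ^ 2)) ≤ 1 - p := by
    rw [← Real.le_log_iff_exp_le hq]
    have := Real.one_sub_inv_le_log_of_pos hq
    have : (1 - p)⁻¹ ≤ 1 + p + 2 * p ^ 2 := by
      rw [inv_le_iff_one_le_mul₀ hq]
      nlinarith [mul_nonneg (sq_nonneg p) (by linarith : 0 ≤ 1 - 2 * p)]
    linarith
  calc Real.exp (-(m * (p + 2 * p ^ 2))) = Real.exp (-(p + 2 * p ^ 2)) ^ m := by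
        rw [← Real.exp_nat_mul]; congr 1; ring
    _ ≤ (1 - p) ^ m := by gcongr

/-- The constant in the lower bound for the probability that a vertex lies in exactly `r`
selected copies, all of them minimum-degree copies. -/
noncomputable def lowConst (k r : ℕ) : ℝ := Real.exp (-1) / ((2 * k) ^ r * r.factorial)

lemma lowConst_pos (hk : 0 < k) (r : ℕ) : 0 < lowConst k r := by
  unfold lowConst
  positivity

lemma lowConst_mul_le {p L : ℝ} {m g r : ℕ} (hk : 0 < k) (h0 : 0 ≤ p) (h1 : p ≤ 1 / 2)
    (hL : L = m * p) (hLm : 2 * L ^ 2 ≤ m) (hm : 0 < m) (hg : m ≤ k * g) (hgr : 2 * r ≤ g) :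
    lowConst k r * L ^ r * Real.exp (-L) ≤
      (g.choose r : ℝ) * (p ^ r * (1 - p) ^ (m - r)) := by
  have hk' : (0 : ℝ) < k := by exact_mod_cast hk
  have hm' : (0 : ℝ) < m := by exact_mod_cast hm
  have hL0 : 0 ≤ L := by rw [hL]; positivity
  have q0 : 0 ≤ 1 - p := by linarith
  have e1 : Real.exp (-1) * Real.exp (-L) ≤ (1 - p) ^ (m - r) := by
    calc Real.exp (-1) * Real.exp (-L) = Real.exp (-(L + 1)) := by
          rw [← Real.exp_add]; congr 1; ring
      _ ≤ Real.exp (-(m * (p + 2 * p ^ 2))) := by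
          apply Real.exp_le_exp.2
          have : (m : ℝ) * (2 * p ^ 2) ≤ 1 := by
            have e : (m : ℝ) * (m * (2 * p ^ 2)) ≤ (m : ℝ) * 1 := by
              calc (m : ℝ) * (m * (2 * p ^ 2)) = 2 * L ^ 2 := by rw [hL]; ring
                _ ≤ (m : ℝ) * 1 := by simpa using hLm
            exact le_of_mul_le_mul_left e hm'
          rw [hL]; linarith
      _ ≤ (1 - p) ^ m := exp_neg_le_one_sub_pow h1 m
      _ ≤ (1 - p) ^ (m - r) := pow_le_pow_of_le_one q0 (by linarith) (Nat.sub_le _ _)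
  have e2 : (m / (2 * k) : ℝ) ^ r / r.factorial ≤ (g.choose r : ℝ) := by
    refine le_trans ?_ (Nat.pow_le_choose r g)
    gcongr
    rw [div_le_iff₀ (by positivity)]
    have : m ≤ (g + 1 - r) * (2 * k) := by
      calc m ≤ k * g := hg
        _ ≤ k * (2 * (g + 1 - r)) := by gcongr; omega
        _ = _ := by ring
    exact_mod_cast this
  calc lowConst k r * L ^ r * Real.exp (-L)
      = (m / (2 * k) : ℝ) ^ r / r.factorial * (p ^ r * (Real.exp (-1) * Real.exp (-L))) := by
        unfold lowConst
        rw [hL, div_pow, mul_pow (m : ℝ) p]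
        field_simp
    _ ≤ _ := by gcongr

/-- Two-point estimate in terms of the expected number `L` of selected members of each family
and a bound `y` for the expected number of selected common members. -/
lemma bprob_pair_le_exp {α : Type*} [DecidableEq α] [Fintype α] {p L B a c y : ℝ} (h0 : 0 ≤ p)
    (h1 : p ≤ 1 / 2) {m g r μ : ℕ} {C C' G G' : Finset α} (hG : G ⊆ C) (hG' : G' ⊆ C')
    (hm : C.card = m) (hm' : C'.card = m) (hg : G.card = g) (hg' : G'.card = g)
    (hμ : (C ∩ C').card = μ) (ha : a = (g.choose r : ℝ) * (p ^ r * (1 - p) ^ (m - r)))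
    (hL : L = m * p) (hL1 : 1 ≤ L) (hy : μ * p ≤ y) (hy1 : y ≤ 1) (hc : 0 < c)
    (hca : c * L ^ r * Real.exp (-L) ≤ a) (hB : B = (r + 1) * Real.exp (1 + r) / c) :
    bprob p Finset.univ (fun S => (S ∩ C ⊆ G ∧ (S ∩ C).card = r) ∧
      (S ∩ C' ⊆ G' ∧ (S ∩ C').card = r)) ≤
      (1 + (Real.exp (4 * y) - 1 + B ^ 2 * y)) * a ^ 2 := by
  have hB0 : 0 ≤ B := by rw [hB]; positivity
  refine (bprob_pair_le (B := B) h0 (by linarith) (Finset.subset_univ _)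
    (Finset.subset_univ _) hG hG' hm hm' hg hg' hμ ha ?_).trans ?_
  · intro A hA
    have ht : p * ((μ : ℝ) + r) ≤ 1 + r := by
      have e1 : (μ : ℝ) * p ≤ 1 := hy.trans hy1
      have e2 : p * (r : ℝ) ≤ r := mul_le_of_le_one_left (Nat.cast_nonneg r) (by linarith)
      linarith
    refine (bprob_card_le_le (m := m) (s := μ) h0 (by linarith) (by omega) (by omega) hL hL1
      ht).trans ?_
    calc (r + 1) * L ^ r * Real.exp (1 + r - L) = B * (c * L ^ r * Real.exp (-L)) := by
          rw [hB, sub_eq_add_neg (1 + r : ℝ), Real.exp_add]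
          field_simp
      _ ≤ B * a := by gcongr
  · have e1 : ((1 - p) ^ μ)⁻¹ ^ 2 ≤ Real.exp (4 * y) := by
      have q0 : 0 < 1 - p := by linarith
      have := exp_neg_le_one_sub_pow h1 (2 * μ)
      rw [inv_pow, ← pow_mul, mul_comm μ 2, inv_le_comm₀ (by positivity) (by positivity),
        ← Real.exp_neg]
      refine le_trans (Real.exp_le_exp.2 ?_) this
      push_cast
      have : (μ : ℝ) * (p + 2 * p ^ 2) ≤ μ * (2 * p) := by
        gcongr
        nlinarith
      linarith
    have e2 : μ * p * B ^ 2 ≤ B ^ 2 * y := by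
      rw [mul_comm]
      gcongr
    refine mul_le_mul_of_nonneg_right ?_ (sq_nonneg a)
    linarith

/-- Explicit bound for the failure probability below the threshold. -/
lemma motifProb_not_exists_lt_le (hk : 0 < k) (hiso : ∀ v, (H.neighborSet v).Nonempty) {d r : ℕ}
    (hdr : r * minDeg H < d) (hn : 2 ≤ n) {p L B : ℝ} (h0 : 0 ≤ p) (h1 : p ≤ 1 / 2)
    (hL : L = mr H n 1 * p) (hL1 : 1 ≤ L) (hLm : 2 * L ^ 2 ≤ mr H n 1)
    (hm : 2 * r * k ≤ mr H n 1) (hLn : k * L / (n - 1) ≤ 1)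
    (hB : B = (r + 1) * Real.exp (1 + r) / lowConst k r) :
    motifProb H n p (fun G => ¬ ∃ v : Fin n, (G.neighborSet v).ncard < d) ≤
      1 / (n * (lowConst k r * L ^ r * Real.exp (-L))) +
        (Real.exp (4 * (k * L / (n - 1))) - 1 + B ^ 2 * (k * L / (n - 1))) := by
  classical
  have hk2 := two_le_of_neighborSet_nonempty hk hiso
  have : Nontrivial (Fin n) := Fin.nontrivial_iff_two_le.2 hn
  have hn0 : 0 < n := by omega
  have hn' : (0 : ℝ) < n - 1 := by
    have : (2 : ℝ) ≤ n := by exact_mod_cast hn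
    linarith
  let v₀ : Fin n := ⟨0, hn0⟩
  have hmv : ∀ v : Fin n, (copiesAt H v).card = mr H n 1 := fun v => (mr_one_eq_card v).symm
  generalize mr H n 1 = m at hL hLm hm hmv
  obtain ⟨g, hgv⟩ : ∃ g, ∀ v : Fin n, (minCopiesAt H v).card = g :=
    ⟨(minCopiesAt H v₀).card, fun v => card_minCopiesAt_eq v v₀⟩
  have hmg : m ≤ k * g := by
    have := card_copiesAt_le hk hiso v₀
    rwa [hmv, hgv] at this
  have hm0 : 0 < m := by
    by_contra h
    have : m = 0 := by omega
    rw [this] at hL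
    norm_num at hL
    linarith
  have hgr : 2 * r ≤ g := by
    refine Nat.le_of_mul_le_mul_left ?_ hk
    calc k * (2 * r) = 2 * r * k := by ring
      _ ≤ k * g := hm.trans hmg
  obtain ⟨a, ha⟩ : ∃ a : ℝ, a = (g.choose r : ℝ) * (p ^ r * (1 - p) ^ (m - r)) := ⟨_, rfl⟩
  obtain ⟨b, hb⟩ : ∃ b : ℝ, b = lowConst k r * L ^ r * Real.exp (-L) := ⟨_, rfl⟩
  have hc := lowConst_pos hk r
  have hb0 : 0 < b := by rw [hb]; positivity
  have hba : b ≤ a := by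
    rw [ha, hb]
    exact lowConst_mul_le hk h0 h1 hL hLm hm0 hmg hgr
  have ha0 : 0 < a := hb0.trans_le hba
  have hx0 : 0 ≤ k * L / (n - 1) := by positivity
  have hnot : motifProb H n p (fun G => ¬ ∃ v : Fin n, (G.neighborSet v).ncard < d) ≤
      bprob p (Finset.univ : Finset (Copy H n)) (fun S => ∀ v : Fin n,
        ¬ (S ∩ copiesAt H v ⊆ minCopiesAt H v ∧ (S ∩ copiesAt H v).card = r)) := by
    rw [motifProb_eq_bprob]
    refine bprob_mono h0 (by linarith) fun S _ hS v hv => hS ⟨v, ?_⟩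
    refine (ncard_neighborSet_graphOfSet_le hv.1).trans_lt ?_
    rwa [hv.2]
  refine hnot.trans ((bprob_forall_not_le (a := a)
    (ε := Real.exp (4 * (k * L / (n - 1))) - 1 + B ^ 2 * (k * L / (n - 1)))
    h0 (by linarith) ha0 ?_ ?_ ?_ ?_).trans ?_)
  · simpa using hn0
  · intro v
    rw [bprob_inter p (Finset.subset_univ _) (fun S => S ⊆ minCopiesAt H v ∧ S.card = r),
      bprob_subset_card_eq p (minCopiesAt_subset v), hgv, hmv, ha]
  · have : 1 ≤ Real.exp (4 * (k * L / (n - 1))) := Real.one_le_exp (by positivity)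
    have : 0 ≤ B ^ 2 * (k * L / (n - 1)) := by positivity
    linarith
  · intro v w hvw
    obtain ⟨μ, hμdef⟩ : ∃ μ, (copiesAt H v ∩ copiesAt H w).card = μ := ⟨_, rfl⟩
    have hμm := card_copiesAt_inter_mul hiso hvw
    rw [hμdef, hmv] at hμm
    have hμ := card_inter_mul_p hk2 hn hμm hL (by linarith)
    exact bprob_pair_le_exp h0 h1 (minCopiesAt_subset v) (minCopiesAt_subset w) (hmv v) (hmv w)
      (hgv v) (hgv w) hμdef ha hL hL1 hμ hLn hc (hb ▸ hba) hB
  · rw [Fintype.card_fin, ← hb]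
    gcongr

end Finite

section Asymptotics

/-- The expected number of selected copies containing a given vertex. -/
noncomputable def expectedCopies (r : ℕ) (y : ℕ → ℝ) (n : ℕ) : ℝ :=
  Real.log n + r * Real.log (Real.log n) + y n

lemma tendsto_log_natCast : Tendsto (fun n : ℕ => Real.log n) atTop atTop :=
  Real.tendsto_log_atTop.comp tendsto_natCast_atTop_atTop

variable {r : ℕ} {y : ℕ → ℝ}

lemma tendsto_expectedCopies_div_log
    (hy : Tendsto (fun n => y n / Real.log (Real.log n)) atTop (nhds 0)) :
    Tendsto (fun n => expectedCopies r y n / Real.log n) atTop (nhds 1) := by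
  have h1 : Tendsto (fun n : ℕ => Real.log (Real.log n) / Real.log n) atTop (nhds 0) :=
    Real.isLittleO_log_id_atTop.tendsto_div_nhds_zero.comp tendsto_log_natCast
  have h2 := ((h1.const_mul (r : ℝ)).const_add 1).add (hy.mul h1)
  simp only [mul_zero, add_zero] at h2
  refine h2.congr' ?_
  filter_upwards [tendsto_log_natCast.eventually_gt_atTop 1] with n hn
  have := Real.log_pos hn
  have : Real.log n ≠ 0 := by positivity
  unfold expectedCopies
  field_simp

lemma tendsto_expectedCopies
    (hy : Tendsto (fun n => y n / Real.log (Real.log n)) atTop (nhds 0)) :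
    Tendsto (expectedCopies r y) atTop atTop := by
  refine ((tendsto_expectedCopies_div_log (r := r) hy).pos_mul_atTop one_pos
    tendsto_log_natCast).congr' ?_
  filter_upwards [tendsto_log_natCast.eventually_gt_atTop 0] with n hn
  exact div_mul_cancel₀ _ hn.ne'

lemma tendsto_expectedCopies_pow_div
    (hy : Tendsto (fun n => y n / Real.log (Real.log n)) atTop (nhds 0)) (j : ℕ) :
    Tendsto (fun n => expectedCopies r y n ^ j / n) atTop (nhds 0) := by
  have h1 : Tendsto (fun n : ℕ => Real.log n ^ j / n) atTop (nhds 0) :=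
    (Real.isLittleO_pow_log_id_atTop (n := j)).tendsto_div_nhds_zero.comp
      tendsto_natCast_atTop_atTop
  have h2 := ((tendsto_expectedCopies_div_log (r := r) hy).pow j).mul h1
  simp only [mul_zero] at h2
  refine h2.congr' ?_
  filter_upwards [tendsto_log_natCast.eventually_gt_atTop 0] with n hn
  rw [div_pow]
  field_simp

lemma tendsto_div_sub_one : Tendsto (fun n : ℕ => (n : ℝ) / (n - 1)) atTop (nhds 1) := by
  have h : Tendsto (fun n : ℕ => (1 : ℝ) - (n : ℝ)⁻¹) atTop (nhds (1 - 0)) :=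
    tendsto_inv_atTop_nhds_zero_nat.const_sub 1
  rw [sub_zero] at h
  have h' := h.inv₀ one_ne_zero
  rw [inv_one] at h'
  refine h'.congr' ?_
  filter_upwards [eventually_ge_atTop 2] with n hn
  have h2 : (2 : ℝ) ≤ n := by exact_mod_cast hn
  have h3 : (n : ℝ) - 1 ≠ 0 := by linarith
  have h4 : (n : ℝ) ≠ 0 := by linarith
  field_simp

lemma tendsto_expectedCopies_pow_div_sub_one
    (hy : Tendsto (fun n => y n / Real.log (Real.log n)) atTop (nhds 0)) (j : ℕ) :
    Tendsto (fun n : ℕ => expectedCopies r y n ^ j / (n - 1)) atTop (nhds 0) := by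
  have h := (tendsto_expectedCopies_pow_div (r := r) hy j).mul tendsto_div_sub_one
  rw [zero_mul] at h
  refine h.congr' ?_
  filter_upwards [eventually_ge_atTop 1] with n hn
  have h4 : (n : ℝ) ≠ 0 := by positivity
  field_simp

/-- The normalised Poisson weight at `r` tends to `1`. -/
lemma tendsto_mul_expectedCopies_pow_mul_exp
    (hy : Tendsto (fun n => y n / Real.log (Real.log n)) atTop (nhds 0)) :
    Tendsto (fun n : ℕ => n * (expectedCopies r y n ^ r * Real.exp (-expectedCopies r y n)) *
      Real.exp (y n)) atTop (nhds 1) := by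
  have h := (tendsto_expectedCopies_div_log (r := r) hy).pow r
  rw [one_pow] at h
  refine h.congr' ?_
  filter_upwards [tendsto_log_natCast.eventually_gt_atTop 0, eventually_ge_atTop 1] with n hn hn1
  have h4 : (0 : ℝ) < n := by positivity
  have e : Real.exp (-expectedCopies r y n) * Real.exp (y n) =
      (n : ℝ)⁻¹ * ((Real.log n)⁻¹) ^ r := by
    have : -expectedCopies r y n + y n = -Real.log n + r * -Real.log (Real.log n) := by
      unfold expectedCopies; ring
    rw [← Real.exp_add, this, Real.exp_add, Real.exp_nat_mul, Real.exp_neg, Real.exp_neg,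
      Real.exp_log h4, Real.exp_log hn]
  rw [mul_assoc, mul_assoc, e, div_eq_mul_inv, mul_pow]
  field_simp

variable {k : ℕ} {H : SimpleGraph (Fin k)}

lemma eventually_edge_conditions (hk : 0 < k) (hiso : ∀ v, (H.neighborSet v).Nonempty)
    (hy : Tendsto (fun n => y n / Real.log (Real.log n)) atTop (nhds 0)) :
    ∀ᶠ n in atTop, 2 ≤ n ∧ 0 ≤ expectedCopies r y n / mr H n 1 ∧
      expectedCopies r y n / mr H n 1 ≤ 1 / 2 ∧
      expectedCopies r y n = mr H n 1 * (expectedCopies r y n / mr H n 1) ∧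
      1 ≤ expectedCopies r y n ∧ 2 * expectedCopies r y n ^ 2 ≤ mr H n 1 ∧
      2 * r * k ≤ mr H n 1 ∧ k * expectedCopies r y n / (n - 1) ≤ 1 := by
  have hk' : (0 : ℝ) < k := by exact_mod_cast hk
  have h1 := (tendsto_expectedCopies_pow_div_sub_one (r := r) hy 1).eventually_le_const
    (inv_pos.2 (by positivity : (0 : ℝ) < 2 * k))
  have h2 := (tendsto_expectedCopies_pow_div_sub_one (r := r) hy 2).eventually_le_const
    (inv_pos.2 (by positivity : (0 : ℝ) < 2 * k))
  filter_upwards [h1, h2, (tendsto_expectedCopies (r := r) hy).eventually_ge_atTop 1,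
    eventually_ge_atTop 2, eventually_ge_atTop k, eventually_ge_atTop (2 * r * k * k + 1)]
    with n h1 h2 hL hn hkn hrn
  have hn' : (0 : ℝ) < n - 1 := by
    have : (2 : ℝ) ≤ n := by exact_mod_cast hn
    linarith
  have hmk : n - 1 ≤ mr H n 1 * k := by
    let v : Fin n := ⟨0, by omega⟩
    rw [mr_one_eq_card v]
    exact (sub_one_le_card_mul hk hiso hkn v).trans (Nat.mul_le_mul_left _ (Nat.sub_le _ _))
  have hmk' : (n : ℝ) - 1 ≤ mr H n 1 * k := by
    have := (Nat.cast_le (α := ℝ)).2 hmk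
    rwa [Nat.cast_sub (by omega), Nat.cast_mul, Nat.cast_one] at this
  have hm : (0 : ℝ) < mr H n 1 := by
    by_contra h
    nlinarith
  generalize expectedCopies r y n = L at *
  rw [div_le_iff₀ hn', pow_one, inv_mul_eq_div, le_div_iff₀ (by positivity)] at h1
  rw [div_le_iff₀ hn', inv_mul_eq_div, le_div_iff₀ (by positivity)] at h2
  refine ⟨hn, by positivity, ?_, by field_simp, hL, ?_, ?_, ?_⟩
  · rw [div_le_iff₀ hm]
    refine le_of_mul_le_mul_right ?_ hk'
    linarith
  · refine le_of_mul_le_mul_right ?_ hk'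
    linarith
  · refine Nat.le_of_mul_le_mul_right ?_ hk
    omega
  · rw [div_le_one hn']
    nlinarith

lemma motifProb_eq_one_sub (n : ℕ) (p : ℝ) (Q : SimpleGraph (Fin n) → Prop) :
    motifProb H n p Q = 1 - motifProb H n p (fun G => ¬ Q G) := by
  classical
  rw [motifProb_eq_bprob, motifProb_eq_bprob, bprob_not]
  ring

lemma motifProb_nonneg {n : ℕ} {p : ℝ} (h0 : 0 ≤ p) (h1 : p ≤ 1)
    (Q : SimpleGraph (Fin n) → Prop) : 0 ≤ motifProb H n p Q := by
  classical
  rw [motifProb_eq_bprob]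
  exact bprob_nonneg h0 h1 _ _

lemma tendsto_motifProb_one {p : ℕ → ℝ} {Q : ∀ n, SimpleGraph (Fin n) → Prop} {f : ℕ → ℝ}
    (hp : ∀ᶠ n in atTop, 0 ≤ p n ∧ p n ≤ 1)
    (hle : ∀ᶠ n in atTop, motifProb H n (p n) (fun G => ¬ Q n G) ≤ f n)
    (hf : Tendsto f atTop (nhds 0)) :
    Tendsto (fun n => motifProb H n (p n) (Q n)) atTop (nhds 1) := by
  have h : Tendsto (fun n => motifProb H n (p n) (fun G => ¬ Q n G)) atTop (nhds 0) :=
    squeeze_zero' (hp.mono fun n hn => motifProb_nonneg hn.1 hn.2 _) hle hf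
  have h' := h.const_sub 1
  rw [sub_zero] at h'
  exact h'.congr fun n => (motifProb_eq_one_sub n _ _).symm

lemma tendsto_motifProb_forall (hk : 0 < k) (hiso : ∀ v, (H.neighborSet v).Nonempty) {d : ℕ}
    (hdr : d ≤ (r + 1) * minDeg H) (hy : Tendsto y atTop atTop)
    (hy' : Tendsto (fun n => y n / Real.log (Real.log n)) atTop (nhds 0)) :
    Tendsto (fun n => motifProb H n (expectedCopies r y n / mr H n 1)
      (fun G => ∀ v : Fin n, d ≤ (G.neighborSet v).ncard)) atTop (nhds 1) := by
  have hev := eventually_edge_conditions (r := r) hk hiso hy'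
  have hβ : Tendsto (fun n : ℕ => n * ((r + 1) * expectedCopies r y n ^ r *
      Real.exp ((2 + r) - expectedCopies r y n))) atTop (nhds 0) := by
    have h := ((tendsto_mul_expectedCopies_pow_mul_exp (r := r) hy').mul
      (Real.tendsto_exp_neg_atTop_nhds_zero.comp hy)).const_mul ((r + 1) * Real.exp (2 + r))
    rw [mul_zero, mul_zero] at h
    refine h.congr fun n => ?_
    simp only [Function.comp_apply]
    rw [sub_eq_add_neg (2 + r : ℝ), Real.exp_add (2 + r : ℝ), Real.exp_neg (y n)]
    field_simp
  have hK : Tendsto (fun n : ℕ => (k * expectedCopies r y n) ^ 2 / ((n : ℝ) - 1))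
      atTop (nhds 0) := by
    have h := (tendsto_expectedCopies_pow_div_sub_one (r := r) hy' 2).const_mul ((k : ℝ) ^ 2)
    rw [mul_zero] at h
    refine h.congr fun n => ?_
    ring
  have hK2 : Tendsto (fun n : ℕ => n * ((k * expectedCopies r y n) ^ 2 / ((n : ℝ) - 1)) ^ 2)
      atTop (nhds 0) := by
    have h := ((tendsto_expectedCopies_pow_div_sub_one (r := r) hy' 4).mul
      tendsto_div_sub_one).const_mul ((k : ℝ) ^ 4)
    rw [zero_mul, mul_zero] at h
    refine h.congr fun n => ?_
    ring
  have hf := (hβ.add (hK.mul hβ)).add hK2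
  simp only [mul_zero, add_zero] at hf
  refine tendsto_motifProb_one (hev.mono fun n h => ⟨h.2.1, by linarith [h.2.2.1]⟩) ?_ hf
  filter_upwards [hev] with n ⟨hn, h0, h1, hL, hL1, _⟩
  refine (motifProb_not_forall_le hk hiso hdr hn h0 (by linarith) hL hL1).trans (le_of_eq ?_)
  ring

lemma tendsto_motifProb_exists (hk : 0 < k) (hiso : ∀ v, (H.neighborSet v).Nonempty) {d : ℕ}
    (hdr : r * minDeg H < d) (hy : Tendsto y atTop atBot)
    (hy' : Tendsto (fun n => y n / Real.log (Real.log n)) atTop (nhds 0)) :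
    Tendsto (fun n => motifProb H n (expectedCopies r y n / mr H n 1)
      (fun G => ∃ v : Fin n, (G.neighborSet v).ncard < d)) atTop (nhds 1) := by
  have hev := eventually_edge_conditions (r := r) hk hiso hy'
  have hfirst : Tendsto (fun n : ℕ => 1 / (n * (lowConst k r * expectedCopies r y n ^ r *
      Real.exp (-expectedCopies r y n)))) atTop (nhds 0) := by
    have h := (((tendsto_mul_expectedCopies_pow_mul_exp (r := r) hy').inv₀ one_ne_zero).mul
      (Real.tendsto_exp_atBot.comp hy)).const_mul (lowConst k r)⁻¹
    rw [mul_zero, mul_zero] at h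
    refine h.congr fun n => ?_
    simp only [Function.comp_apply, one_div, mul_inv]
    field_simp
  have hK : Tendsto (fun n : ℕ => k * expectedCopies r y n / ((n : ℝ) - 1))
      atTop (nhds 0) := by
    have h := (tendsto_expectedCopies_pow_div_sub_one (r := r) hy' 1).const_mul (k : ℝ)
    rw [mul_zero] at h
    refine h.congr fun n => ?_
    ring
  have hexp := (Real.continuous_exp.tendsto _).comp (hK.const_mul 4)
  rw [mul_zero, Real.exp_zero] at hexp
  have hf := hfirst.add ((hexp.sub_const 1).add (hK.const_mul
    ((((r : ℝ) + 1) * Real.exp (1 + r) / lowConst k r) ^ 2)))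
  simp only [mul_zero, add_zero, sub_self] at hf
  refine tendsto_motifProb_one (hev.mono fun n h => ⟨h.2.1, by linarith [h.2.2.1]⟩) ?_ hf
  filter_upwards [hev] with n ⟨hn, h0, h1, hL, hL1, hLm, hm, hLn⟩
  exact motifProb_not_exists_lt_le hk hiso hdr hn h0 h1 hL hL1 hLm hm hLn rfl

end Asymptotics

/-- **Theorem (minimum degree).**  For fixed `d ≥ 1`, w.h.p. the minimum degree of
`G(H,n,p_d^-(H))` is `< d`, and w.h.p. the minimum degree of `G(H,n,p_d^+(H))` is `≥ d`. -/
theorem min_degree_threshold {k : ℕ} (H : SimpleGraph (Fin k)) (hk : 0 < k)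
    (hiso : ∀ v, (H.neighborSet v).Nonempty) (d : ℕ) (hd : 1 ≤ d)
    (x : ℕ → ℝ) (hx : Tendsto x atTop atTop)
    (hx' : Tendsto (fun n => x n / Real.log (Real.log n)) atTop (nhds 0)) :
    Tendsto (fun n => motifProb H n (pMinus H d x n)
        (fun G => ∃ v : Fin n, (G.neighborSet v).ncard < d)) atTop (nhds 1) ∧
    Tendsto (fun n => motifProb H n (pPlus H d x n)
        (fun G => ∀ v : Fin n, d ≤ (G.neighborSet v).ncard)) atTop (nhds 1) := by
  obtain ⟨hlow, hhigh⟩ := deltad_bounds hk hiso hd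
  have hneg : Tendsto (fun n => -x n / Real.log (Real.log n)) atTop (nhds 0) := by
    simpa [neg_div] using hx'.neg
  refine ⟨?_, tendsto_motifProb_forall hk hiso hhigh hx hx'⟩
  simpa only [expectedCopies, pMinus, sub_eq_add_neg] using
    tendsto_motifProb_exists (y := fun n => -x n) hk hiso hlow
      (tendsto_neg_atTop_atBot.comp hx) hneg

end RandomMotif
end

section
/- Let H be a fixed graph and suppose p = p(n) satisfies p·m_1(H) = ln n ± o(ln n). Then with probability tending to 1 as n → ∞, every connected component of G(H,n,p) has cardinality either 1 or at least n/2. In particular, w.h.p. G(H,n,p) has a unique component of linear size and all remaining vertices are isolated. -/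
open Filter

namespace RandomMotif

section Probability

variable {k n : ℕ} {H : SimpleGraph (Fin k)} {p : ℝ}

lemma selProb_mono (h₀ : 0 ≤ p) (h₁ : p ≤ 1) {P Q : (Copy H n → Bool) → Prop}
    (hPQ : ∀ ω, P ω → Q ω) : selProb H n p P ≤ selProb H n p Q := by
  classical
  refine Finset.sum_le_sum fun ω _ =>
    mul_le_mul_of_nonneg_left ?_ (Finset.prod_nonneg fun c _ => ?_)
  · by_cases h : P ω
    · simp [h, hPQ ω h]
    · simp only [h, if_false]
      split_ifs <;> norm_num
  · split_ifs <;> linarith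

/-- The union bound. -/
lemma selProb_exists_le {ι : Type*} (h₀ : 0 ≤ p) (h₁ : p ≤ 1) (I : Finset ι)
    (P : ι → (Copy H n → Bool) → Prop) :
    selProb H n p (fun ω => ∃ i ∈ I, P i ω) ≤ ∑ i ∈ I, selProb H n p (P i) := by
  classical
  unfold selProb
  rw [Finset.sum_comm]
  refine Finset.sum_le_sum fun ω _ => ?_
  rw [← Finset.mul_sum]
  refine mul_le_mul_of_nonneg_left ?_ (Finset.prod_nonneg fun c _ => ?_)
  · have hnn : ∀ i ∈ I, (0 : ℝ) ≤ if P i ω then 1 else 0 := fun i _ => by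
      split_ifs <;> norm_num
    split_ifs with h
    · obtain ⟨i, hi, hP⟩ := h
      calc (1 : ℝ) = if P i ω then 1 else 0 := by simp [hP]
        _ ≤ _ := Finset.single_le_sum hnn hi
    · exact Finset.sum_nonneg hnn
  · split_ifs <;> linarith

/-- The probability that all copies in `T` and no copies in `Y` are selected. -/
lemma selProb_cylinder (T Y : Finset (Copy H n)) (hTY : Disjoint T Y) :
    selProb H n p (fun ω => (∀ c ∈ T, ω c = true) ∧ ∀ c ∈ Y, ω c = false) =
      p ^ T.card * (1 - p) ^ Y.card := by
  classical
  have key : ∀ ω : Copy H n → Bool,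
      (∏ c : Copy H n, if ω c then p else 1 - p) *
        (if (∀ c ∈ T, ω c = true) ∧ ∀ c ∈ Y, ω c = false then 1 else 0) =
      ∏ c : Copy H n, (if ω c then (if c ∈ Y then 0 else p)
        else (if c ∈ T then 0 else 1 - p)) := by
    intro ω
    split_ifs with h
    · rw [mul_one]
      refine Finset.prod_congr rfl fun c _ => ?_
      by_cases hT : c ∈ T
      · simp [h.1 c hT, Finset.disjoint_left.1 hTY hT]
      · by_cases hY : c ∈ Y
        · simp [h.2 c hY, hT]
        · simp [hT, hY]
    · rw [mul_zero, eq_comm]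
      rw [not_and_or] at h
      push Not at h
      rcases h with ⟨c, hc, hω⟩ | ⟨c, hc, hω⟩
      · exact Finset.prod_eq_zero (Finset.mem_univ c) (by simp [hc, hω])
      · exact Finset.prod_eq_zero (Finset.mem_univ c) (by simp [hc, hω])
  unfold selProb
  calc _ = ∑ ω : Copy H n → Bool, ∏ c : Copy H n, (if ω c then (if c ∈ Y then 0 else p)
        else (if c ∈ T then 0 else 1 - p)) := Finset.sum_congr rfl fun ω _ => by
          rw [← key]
          congr!
    _ = ∏ c : Copy H n, ∑ b : Bool, (if b then (if c ∈ Y then 0 else p)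
        else (if c ∈ T then 0 else 1 - p)) := by
          rw [Finset.prod_univ_sum, Fintype.piFinset_univ]
    _ = ∏ c : Copy H n, (if c ∈ T then p else 1) * (if c ∈ Y then 1 - p else 1) := by
          refine Finset.prod_congr rfl fun c _ => ?_
          by_cases hT : c ∈ T
          · simp [hT, Finset.disjoint_left.1 hTY hT]
          · by_cases hY : c ∈ Y <;> simp [hT, hY]
    _ = _ := by
          rw [Finset.prod_mul_distrib]
          simp [Finset.prod_ite_mem]

lemma selProb_true : selProb H n p (fun _ => True) = 1 := by
  simpa using selProb_cylinder (H := H) (n := n) (p := p) ∅ ∅ (by simp)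

lemma selProb_not (P : (Copy H n → Bool) → Prop) :
    selProb H n p (fun ω => ¬ P ω) = 1 - selProb H n p P := by
  classical
  rw [← selProb_true (H := H) (n := n) (p := p), eq_sub_iff_add_eq]
  unfold selProb
  rw [← Finset.sum_add_distrib]
  refine Finset.sum_congr rfl fun ω _ => ?_
  by_cases h : P ω <;> simp [h]

lemma graphOf_adj (ω : Copy H n → Bool) (u v : Fin n) :
    (graphOf ω).Adj u v ↔ ∃ c : Copy H n, ω c = true ∧ c.1.Adj u v := by
  unfold graphOf
  rw [SimpleGraph.iSup_adj]
  refine exists_congr fun c => ?_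
  split_ifs with h <;> simp [h]

end Probability

section Counting

open Classical in
/-- The vertex set of a copy. -/
noncomputable def Copy.verts {k n : ℕ} {H : SimpleGraph (Fin k)} (c : Copy H n) :
    Finset (Fin n) :=
  Finset.univ.filter fun v => v ∈ c.1.support

open Classical in
/-- The number of copies `c` for which `R c u v` holds. -/
noncomputable def copyCount {k : ℕ} (H : SimpleGraph (Fin k)) (n : ℕ)
    (R : SimpleGraph (Fin n) → Fin n → Fin n → Prop) (u v : Fin n) : ℕ :=
  (Finset.univ.filter fun c : Copy H n => R c.1 u v).card

open Classical in
/-- The copies with an edge between `S` and its complement. -/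
noncomputable def crossing {k : ℕ} (H : SimpleGraph (Fin k)) {n : ℕ} (S : Finset (Fin n)) :
    Finset (Copy H n) :=
  Finset.univ.filter fun c => ∃ u ∈ S, ∃ v ∉ S, c.1.Adj u v

open Classical in
/-- The copies with an edge inside `S` and no edge between `S` and its complement. -/
noncomputable def inner {k : ℕ} (H : SimpleGraph (Fin k)) {n : ℕ} (S : Finset (Fin n)) :
    Finset (Copy H n) :=
  (Finset.univ.filter fun c => ∃ u ∈ S, ∃ v ∈ S, c.1.Adj u v) \ crossing H S

variable {k n : ℕ} {H : SimpleGraph (Fin k)}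

lemma Copy.mem_verts {c : Copy H n} {v : Fin n} : v ∈ c.verts ↔ ∃ w, c.1.Adj v w := by
  simp [Copy.verts, SimpleGraph.mem_support]

lemma Copy.card_verts (hiso : ∀ v, (H.neighborSet v).Nonempty) (c : Copy H n) :
    c.verts.card = k := by
  classical
  obtain ⟨G, f, rfl⟩ := c
  have : Copy.verts (⟨H.map f, f, rfl⟩ : Copy H n) = Finset.univ.map f := by
    ext v
    rw [Copy.mem_verts]
    simp only [Finset.mem_map, Finset.mem_univ, true_and]
    constructor
    · rintro ⟨w, hw⟩
      obtain ⟨a, b, -, rfl, -⟩ := (SimpleGraph.map_adj f H v w).1 hw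
      exact ⟨a, rfl⟩
    · rintro ⟨a, rfl⟩
      obtain ⟨b, hb⟩ := hiso a
      exact ⟨f b, (SimpleGraph.map_adj f H _ _).2 ⟨a, b, hb, rfl, rfl⟩⟩
  rw [this]
  simp

/-- Relabelling the vertices of a copy by a permutation. -/
noncomputable def Copy.relabel (π : Equiv.Perm (Fin n)) (c : Copy H n) : Copy H n :=
  ⟨c.1.map π.toEmbedding, by
    obtain ⟨f, hf⟩ := c.2
    exact ⟨f.trans π.toEmbedding, by rw [hf, SimpleGraph.map_map]; rfl⟩⟩

lemma Copy.relabel_injective (π : Equiv.Perm (Fin n)) :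
    Function.Injective (Copy.relabel (H := H) π) := fun _ _ h =>
  Subtype.ext (SimpleGraph.map_injective π.toEmbedding (congrArg Subtype.val h))

lemma Copy.relabel_adj (π : Equiv.Perm (Fin n)) (c : Copy H n) (u v : Fin n) :
    (c.relabel π).1.Adj (π u) (π v) ↔ c.1.Adj u v :=
  SimpleGraph.map_adj_apply (f := π.toEmbedding)

lemma copyCount_le {R : SimpleGraph (Fin n) → Fin n → Fin n → Prop} {u v u' v' : Fin n}
    (π : Equiv.Perm (Fin n)) (hu : π u = u') (hv : π v = v')
    (hR : ∀ c : Copy H n, R c.1 u v → R (c.relabel π).1 (π u) (π v)) :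
    copyCount H n R u v ≤ copyCount H n R u' v' := by
  classical
  subst hu hv
  refine Finset.card_le_card_of_injOn (Copy.relabel π) ?_ (Copy.relabel_injective π).injOn
  intro c hc
  simp only [Finset.coe_filter, Finset.mem_univ, true_and, Set.mem_ofPred_eq] at hc ⊢
  exact hR c hc

lemma exists_perm_pair {u v u' v' : Fin n} (h : u ≠ v) (h' : u' ≠ v') :
    ∃ π : Equiv.Perm (Fin n), π u = u' ∧ π v = v' := by
  refine ⟨(Equiv.swap u u').trans (Equiv.swap (Equiv.swap u u' v) v'), ?_, by simp⟩
  have : Equiv.swap u u' v ≠ u' := by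
    intro hc
    exact h ((Equiv.swap u u').injective (by rw [hc, Equiv.swap_apply_left]))
  simp [Equiv.swap_apply_of_ne_of_ne this.symm h']

/-- Two vertices lying in a common copy. -/
def Joint (G : SimpleGraph (Fin n)) (u v : Fin n) : Prop := u ∈ G.support ∧ v ∈ G.support

lemma joint_relabel (π : Equiv.Perm (Fin n)) (c : Copy H n) (u v : Fin n)
    (h : Joint c.1 u v) : Joint (c.relabel π).1 (π u) (π v) := by
  obtain ⟨⟨a, ha⟩, ⟨b, hb⟩⟩ := h
  exact ⟨⟨π a, (c.relabel_adj π _ _).2 ha⟩, ⟨π b, (c.relabel_adj π _ _).2 hb⟩⟩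

lemma copyCount_joint_eq {u v u' v' : Fin n} (h : u ≠ v) (h' : u' ≠ v') :
    copyCount H n Joint u v = copyCount H n Joint u' v' := by
  obtain ⟨π, h1, h2⟩ := exists_perm_pair h h'
  obtain ⟨ρ, h3, h4⟩ := exists_perm_pair h' h
  exact le_antisymm (copyCount_le π h1 h2 fun c => joint_relabel π c _ _)
    (copyCount_le ρ h3 h4 fun c => joint_relabel ρ c _ _)

lemma copyCount_adj_eq {u v u' v' : Fin n} (h : u ≠ v) (h' : u' ≠ v') :
    copyCount H n SimpleGraph.Adj u v = copyCount H n SimpleGraph.Adj u' v' := by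
  obtain ⟨π, h1, h2⟩ := exists_perm_pair h h'
  obtain ⟨ρ, h3, h4⟩ := exists_perm_pair h' h
  exact le_antisymm (copyCount_le π h1 h2 fun c => (c.relabel_adj π _ _).2)
    (copyCount_le ρ h3 h4 fun c => (c.relabel_adj ρ _ _).2)

open Classical in
lemma card_filter_mem_verts (hn : 0 < n) (v : Fin n) :
    (Finset.univ.filter fun c : Copy H n => v ∈ c.verts).card = mr H n 1 := by
  have h0 : mr H n 1 = copyCount H n Joint ⟨0, hn⟩ ⟨0, hn⟩ := by
    have e : {G : SimpleGraph (Fin n) // IsCopy H G ∧ ∃ v ∈ G.support, (v : ℕ) < 1} ≃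
        {c : Copy H n // Joint c.1 ⟨0, hn⟩ ⟨0, hn⟩} :=
      { toFun := fun G => ⟨⟨G.1, G.2.1⟩, by
          obtain ⟨v, hv, hlt⟩ := G.2.2
          have : v = ⟨0, hn⟩ := Fin.ext (by simpa using hlt)
          exact this ▸ ⟨hv, hv⟩⟩
        invFun := fun c => ⟨c.1.1, c.1.2, _, c.2.1, by simp⟩
        left_inv := fun _ => rfl
        right_inv := fun _ => rfl }
    rw [mr, Nat.card_congr e, Nat.card_eq_fintype_card, Fintype.card_subtype, copyCount]
  have h1 : (Finset.univ.filter fun c : Copy H n => v ∈ c.verts).card =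
      copyCount H n Joint v v := by
    simp [copyCount, Joint, Copy.verts]
  rw [h0, h1]
  exact le_antisymm
    (copyCount_le (Equiv.swap v ⟨0, hn⟩) (by simp) (by simp) fun c => joint_relabel _ c _ _)
    (copyCount_le (Equiv.swap v ⟨0, hn⟩) (by simp) (by simp) fun c => joint_relabel _ c _ _)

open Classical in
/-- Double counting of pairs: a copy and a pair in `P` satisfying `R`. -/
lemma sum_copyCount (R : SimpleGraph (Fin n) → Fin n → Fin n → Prop)
    (P : Finset (Fin n × Fin n)) :
    ∑ x ∈ P, copyCount H n R x.1 x.2 =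
      ∑ c : Copy H n, (P.filter fun x => R c.1 x.1 x.2).card := by
  unfold copyCount
  simp only [Finset.card_filter]
  rw [Finset.sum_comm]

/-- The number of copies through two given distinct vertices. -/
lemma copyCount_joint_mul (hiso : ∀ v, (H.neighborSet v).Nonempty) {u v : Fin n} (h : u ≠ v) :
    copyCount H n Joint u v * (n - 1) = (k - 1) * mr H n 1 := by
  classical
  have hn : 0 < n := u.pos
  have h1 := sum_copyCount (H := H) Joint (({u} : Finset (Fin n)) ×ˢ (Finset.univ.erase u))
  have h2 : ∑ x ∈ (({u} : Finset (Fin n)) ×ˢ (Finset.univ.erase u)),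
      copyCount H n Joint x.1 x.2 = (n - 1) * copyCount H n Joint u v := by
    rw [Finset.sum_congr rfl (g := fun _ => copyCount H n Joint u v)]
    · simp
    · rintro ⟨a, b⟩ hx
      simp only [Finset.mem_product, Finset.mem_singleton, Finset.mem_erase, Finset.mem_univ,
        and_true] at hx
      exact copyCount_joint_eq (by rw [hx.1]; exact hx.2.symm) h
  have h3 : ∀ c : Copy H n, ((({u} : Finset (Fin n)) ×ˢ (Finset.univ.erase u)).filter
      fun x => Joint c.1 x.1 x.2).card = if u ∈ c.verts then k - 1 else 0 := by
    intro c
    split_ifs with hu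
    · have hcard : (({u} : Finset (Fin n)) ×ˢ c.verts.erase u).card = k - 1 := by
        rw [Finset.card_product, Finset.card_singleton, one_mul, Finset.card_erase_of_mem hu,
          c.card_verts hiso]
      rw [← hcard]
      congr 1
      ext ⟨a, b⟩
      simp only [Copy.verts, Finset.mem_filter, Finset.mem_univ, true_and] at hu
      simp only [Finset.mem_filter, Finset.mem_product, Finset.mem_singleton, Finset.mem_erase,
        Finset.mem_univ, and_true, Copy.verts, true_and]
      unfold Joint
      constructor
      · rintro ⟨⟨rfl, h2⟩, -, h4⟩
        exact ⟨rfl, h2, h4⟩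
      · rintro ⟨rfl, h2, h4⟩
        exact ⟨⟨rfl, h2⟩, hu, h4⟩
    · rw [Finset.card_eq_zero, Finset.filter_eq_empty_iff]
      rintro ⟨a, b⟩ hx hJ
      simp only [Finset.mem_product, Finset.mem_singleton] at hx
      refine hu ?_
      rw [← hx.1]
      simpa [Copy.verts] using hJ.1
  rw [h2, Finset.sum_congr rfl fun c _ => h3 c, ← Finset.sum_filter, Finset.sum_const,
    card_filter_mem_verts hn, smul_eq_mul] at h1
  rw [mul_comm, h1, mul_comm]

/-- Every edge lies in many copies. -/
lemma mr_le_copyCount_adj_mul {u v : Fin n} (h : u ≠ v) :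
    mr H n 1 ≤ copyCount H n SimpleGraph.Adj u v * (n - 1) := by
  classical
  have hn : 0 < n := u.pos
  have h1 := sum_copyCount (H := H) SimpleGraph.Adj
    (({u} : Finset (Fin n)) ×ˢ (Finset.univ.erase u))
  have h2 : ∑ x ∈ (({u} : Finset (Fin n)) ×ˢ (Finset.univ.erase u)),
      copyCount H n SimpleGraph.Adj x.1 x.2 = (n - 1) * copyCount H n SimpleGraph.Adj u v := by
    rw [Finset.sum_congr rfl (g := fun _ => copyCount H n SimpleGraph.Adj u v)]
    · simp
    · rintro ⟨a, b⟩ hx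
      simp only [Finset.mem_product, Finset.mem_singleton, Finset.mem_erase, Finset.mem_univ,
        and_true] at hx
      exact copyCount_adj_eq (by rw [hx.1]; exact hx.2.symm) h
  rw [mul_comm, ← h2, h1, ← card_filter_mem_verts hn u, Finset.card_filter]
  refine Finset.sum_le_sum fun c _ => ?_
  split_ifs with hu
  · obtain ⟨w, hw⟩ := Copy.mem_verts.1 hu
    refine Finset.card_pos.2 ⟨(u, w), ?_⟩
    simp [hw, hw.ne']
  · exact Nat.zero_le _

open Classical in
lemma sum_card_verts_inter (hn : 0 < n) (S : Finset (Fin n)) :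
    ∑ c : Copy H n, (c.verts ∩ S).card = S.card * mr H n 1 := by
  have : ∀ c : Copy H n, (c.verts ∩ S).card = ∑ v ∈ S, if v ∈ c.verts then 1 else 0 := by
    intro c
    rw [← Finset.card_filter, Finset.filter_mem_eq_inter, Finset.inter_comm]
  rw [Finset.sum_congr rfl fun c _ => this c, Finset.sum_comm]
  simp only [← Finset.card_filter]
  rw [Finset.sum_congr rfl fun v _ => card_filter_mem_verts hn v]
  simp

open Classical in
lemma sum_offDiag_verts_inter {u v : Fin n} (h : u ≠ v) (S : Finset (Fin n)) :
    ∑ c : Copy H n, (c.verts ∩ S).offDiag.card =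
      S.offDiag.card * copyCount H n Joint u v := by
  have h1 := sum_copyCount (H := H) Joint S.offDiag
  rw [Finset.sum_congr rfl (g := fun _ => copyCount H n Joint u v), Finset.sum_const,
    smul_eq_mul] at h1
  · rw [h1]
    refine Finset.sum_congr rfl fun c _ => ?_
    refine congrArg Finset.card (Finset.ext fun x => ?_)
    simp only [Copy.verts, Finset.mem_offDiag, Finset.mem_inter, Finset.mem_filter,
      Finset.mem_univ, true_and]
    unfold Joint
    tauto
  · rintro ⟨a, b⟩ hx
    exact copyCount_joint_eq (Finset.mem_offDiag.1 hx).2.2 h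

lemma card_inner_le {u v : Fin n} (h : u ≠ v) (S : Finset (Fin n)) :
    (inner H S).card ≤ S.card ^ 2 * copyCount H n Joint u v := by
  classical
  have h1 : (inner H S).card ≤ ∑ c : Copy H n, (c.verts ∩ S).offDiag.card := by
    rw [← Finset.sum_filter_add_sum_filter_not Finset.univ (· ∈ inner H S)]
    refine le_trans ?_ (Nat.le_add_right _ _)
    rw [Finset.filter_mem_eq_inter, Finset.univ_inter, Finset.card_eq_sum_ones]
    refine Finset.sum_le_sum fun c hc => ?_
    simp only [inner, Finset.mem_sdiff, Finset.mem_filter, Finset.mem_univ, true_and] at hc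
    obtain ⟨⟨a, ha, b, hb, hab⟩, -⟩ := hc
    refine Finset.card_pos.2 ⟨(a, b), ?_⟩
    simp only [Finset.mem_offDiag, Finset.mem_inter, Copy.mem_verts]
    exact ⟨⟨⟨b, hab⟩, ha⟩, ⟨⟨a, hab.symm⟩, hb⟩, hab.ne⟩
  rw [sum_offDiag_verts_inter h] at h1
  refine h1.trans (Nat.mul_le_mul_right _ ?_)
  rw [Finset.offDiag_card, sq]
  exact Nat.sub_le _ _

lemma card_mul_mr_le {u v : Fin n} (h : u ≠ v) (S : Finset (Fin n)) :
    S.card * mr H n 1 ≤ (crossing H S).card + S.card ^ 2 * copyCount H n Joint u v := by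
  classical
  have h1 : S.card * mr H n 1 ≤
      (crossing H S).card + ∑ c : Copy H n, (c.verts ∩ S).offDiag.card := by
    rw [← sum_card_verts_inter u.pos, crossing, Finset.card_filter, ← Finset.sum_add_distrib]
    refine Finset.sum_le_sum fun c _ => ?_
    rw [Finset.offDiag_card]
    rcases Nat.lt_trichotomy (c.verts ∩ S).card 1 with hj | hj | hj
    · omega
    · obtain ⟨a, ha⟩ := Finset.card_eq_one.1 hj
      have haS : a ∈ c.verts ∩ S := by simp [ha]
      rw [Finset.mem_inter] at haS
      obtain ⟨b, hb⟩ := Copy.mem_verts.1 haS.1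
      have : ∃ u ∈ S, ∃ v ∉ S, c.1.Adj u v := by
        refine ⟨a, haS.2, b, fun hbS => ?_, hb⟩
        have : b ∈ c.verts ∩ S := Finset.mem_inter.2 ⟨Copy.mem_verts.2 ⟨a, hb.symm⟩, hbS⟩
        rw [ha, Finset.mem_singleton] at this
        exact hb.ne this.symm
      rw [if_pos this]
      omega
    · generalize (c.verts ∩ S).card = j at hj
      have : 2 * j ≤ j * j := Nat.mul_le_mul_right _ hj
      omega
  rw [sum_offDiag_verts_inter h] at h1
  refine h1.trans (Nat.add_le_add_left (Nat.mul_le_mul_right _ ?_) _)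
  rw [Finset.offDiag_card, sq]
  exact Nat.sub_le _ _

lemma card_mul_compl_mul_le (hiso : ∀ v, (H.neighborSet v).Nonempty) {u v : Fin n} (h : u ≠ v)
    (S : Finset (Fin n)) :
    S.card * (n - S.card) * copyCount H n SimpleGraph.Adj u v ≤
      k ^ 2 * (crossing H S).card := by
  classical
  have h1 := sum_copyCount (H := H) SimpleGraph.Adj (S ×ˢ Sᶜ)
  rw [Finset.sum_congr rfl (g := fun _ => copyCount H n SimpleGraph.Adj u v), Finset.sum_const,
    smul_eq_mul, Finset.card_product, Finset.card_compl, Fintype.card_fin] at h1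
  · rw [h1, crossing, Finset.card_filter, Finset.mul_sum]
    refine Finset.sum_le_sum fun c _ => ?_
    split_ifs with hc
    · have hcard : (c.verts ×ˢ c.verts).card = k ^ 2 := by
        rw [Finset.card_product, c.card_verts hiso, sq]
      rw [mul_one, ← hcard]
      refine Finset.card_le_card fun x hx => ?_
      have hadj := (Finset.mem_filter.1 hx).2
      exact Finset.mem_product.2
        ⟨Copy.mem_verts.2 ⟨_, hadj⟩, Copy.mem_verts.2 ⟨_, hadj.symm⟩⟩
    · rw [mul_zero, Nat.le_zero, Finset.card_eq_zero, Finset.filter_eq_empty_iff]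
      rintro ⟨a, b⟩ hx hab
      rw [Finset.mem_product, Finset.mem_compl] at hx
      exact hc ⟨a, hx.1, b, hx.2, hab⟩
  · rintro ⟨a, b⟩ hx
    rw [Finset.mem_product, Finset.mem_compl] at hx
    exact copyCount_adj_eq (fun hab => hx.2 (hab ▸ hx.1)) h

end Counting

section Bad

variable {k n : ℕ} {H : SimpleGraph (Fin k)} {p : ℝ}

/-- No edge of `G` leaves `S` and, if `S` is small, no vertex of `S` is isolated. -/
def Bad (S : Finset (Fin n)) (G : SimpleGraph (Fin n)) : Prop :=
  (∀ u ∈ S, ∀ v ∉ S, ¬ G.Adj u v) ∧ (S.card ^ 4 ≤ n → ∀ u ∈ S, ∃ v ∈ S, G.Adj u v)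

lemma not_selected_of_mem_crossing {S : Finset (Fin n)} {ω : Copy H n → Bool}
    (h : ∀ u ∈ S, ∀ v ∉ S, ¬ (graphOf ω).Adj u v) : ∀ c ∈ crossing H S, ω c = false := by
  classical
  intro c hc
  simp only [crossing, Finset.mem_filter, Finset.mem_univ, true_and] at hc
  obtain ⟨u, hu, v, hv, huv⟩ := hc
  by_contra hω
  exact h u hu v hv ((graphOf_adj ω u v).2 ⟨c, by simpa using hω, huv⟩)

lemma motifProb_bad_le (h₀ : 0 ≤ p) (h₁ : p ≤ 1) (S : Finset (Fin n)) :
    motifProb H n p (Bad S) ≤ (1 - p) ^ (crossing H S).card := by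
  refine (selProb_mono h₀ h₁ fun ω hω => ?_).trans
    ((selProb_cylinder ∅ (crossing H S) (Finset.disjoint_empty_left _)).trans (by simp)).le
  exact ⟨by simp, not_selected_of_mem_crossing hω.1⟩

lemma motifProb_bad_le_of_small (hiso : ∀ v, (H.neighborSet v).Nonempty)
    (h₀ : 0 ≤ p) (h₁ : p ≤ 1) (S : Finset (Fin n)) (hS : S.card ^ 4 ≤ n)
    {t : ℕ} (ht : t * k < S.card + k) :
    motifProb H n p (Bad S) ≤
      ((inner H S).card * p) ^ t * (1 - p) ^ (crossing H S).card := by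
  classical
  have hdisj : ∀ T ∈ Finset.powersetCard t (inner H S), Disjoint T (crossing H S) :=
    fun T hT => Finset.disjoint_of_subset_left (Finset.mem_powersetCard.1 hT).1
      Finset.sdiff_disjoint
  have hsub : ∀ ω : Copy H n → Bool, Bad S (graphOf ω) →
      ∃ T ∈ Finset.powersetCard t (inner H S),
        (∀ c ∈ T, ω c = true) ∧ ∀ c ∈ crossing H S, ω c = false := by
    intro ω hω
    have hcross := not_selected_of_mem_crossing hω.1
    set F := (inner H S).filter fun c => ω c = true with hF
    have hcover : S ⊆ F.biUnion Copy.verts := by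
      intro u hu
      obtain ⟨v, hv, huv⟩ := hω.2 hS u hu
      obtain ⟨c, hc, hcuv⟩ := (graphOf_adj ω u v).1 huv
      refine Finset.mem_biUnion.2 ⟨c, ?_, Copy.mem_verts.2 ⟨v, hcuv⟩⟩
      rw [hF, Finset.mem_filter, inner, Finset.mem_sdiff, Finset.mem_filter]
      refine ⟨⟨⟨Finset.mem_univ _, u, hu, v, hv, hcuv⟩, fun hcr => ?_⟩, hc⟩
      simp [hcross c hcr] at hc
    have hcard : S.card ≤ F.card * k :=
      (Finset.card_le_card hcover).trans
        (Finset.card_biUnion_le_card_mul _ _ _ fun c _ => (c.card_verts hiso).le)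
    have htF : t ≤ F.card := by
      by_contra! hlt
      have := Nat.mul_le_mul_right k (Nat.succ_le_of_lt hlt)
      rw [Nat.succ_mul] at this
      omega
    obtain ⟨T, hTF, hT⟩ := Finset.exists_subset_card_eq htF
    refine ⟨T, Finset.mem_powersetCard.2 ⟨hTF.trans (Finset.filter_subset _ _), hT⟩,
      fun c hc => (Finset.mem_filter.1 (hTF hc)).2, hcross⟩
  calc motifProb H n p (Bad S)
      ≤ selProb H n p (fun ω => ∃ T ∈ Finset.powersetCard t (inner H S),
          (∀ c ∈ T, ω c = true) ∧ ∀ c ∈ crossing H S, ω c = false) :=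
        selProb_mono h₀ h₁ hsub
    _ ≤ _ := selProb_exists_le h₀ h₁ _ _
    _ = ∑ T ∈ Finset.powersetCard t (inner H S), p ^ t * (1 - p) ^ (crossing H S).card := by
        refine Finset.sum_congr rfl fun T hT => ?_
        rw [selProb_cylinder T _ (hdisj T hT), (Finset.mem_powersetCard.1 hT).2]
    _ = ((inner H S).card.choose t : ℝ) * (p ^ t * (1 - p) ^ (crossing H S).card) := by
        rw [Finset.sum_const, Finset.card_powersetCard, nsmul_eq_mul]
    _ ≤ ((inner H S).card : ℝ) ^ t * (p ^ t * (1 - p) ^ (crossing H S).card) := by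
        refine mul_le_mul_of_nonneg_right ?_
          (mul_nonneg (pow_nonneg h₀ _) (pow_nonneg (sub_nonneg.2 h₁) _))
        exact_mod_cast Nat.choose_le_pow _ _
    _ = _ := by rw [mul_pow, mul_assoc]

lemma one_sub_pow_le_exp (h₁ : p ≤ 1) (m : ℕ) : (1 - p) ^ m ≤ Real.exp (-(p * m)) := by
  calc (1 - p) ^ m ≤ Real.exp (-p) ^ m :=
        pow_le_pow_left₀ (sub_nonneg.2 h₁) (Real.one_sub_le_exp_neg p) m
    _ = _ := by rw [← Real.exp_nat_mul]; congr 1; ring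

/-- In a graph without bad sets every component is a single vertex or has more than half of
the vertices, and exactly one component is of the latter kind. -/
lemma components_of_not_bad (hn : 4 ≤ n) (G : SimpleGraph (Fin n))
    (hG : ∀ S : Finset (Fin n), 2 ≤ S.card → 2 * S.card ≤ n → ¬ Bad S G) :
    (∀ C : G.ConnectedComponent, C.supp.ncard = 1 ∨ (n : ℝ) / 2 ≤ (C.supp.ncard : ℝ)) ∧
    (∃! C : G.ConnectedComponent, (n : ℝ) / 2 ≤ (C.supp.ncard : ℝ)) ∧
    (∀ C : G.ConnectedComponent, (C.supp.ncard : ℝ) < (n : ℝ) / 2 →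
      ∀ v ∈ C.supp, G.neighborSet v = ∅) := by
  classical
  have hpos : ∀ C : G.ConnectedComponent, 0 < C.supp.ncard := fun C =>
    (Set.ncard_pos (Set.toFinite _)).2 C.nonempty_supp
  have hdich : ∀ C : G.ConnectedComponent, C.supp.ncard = 1 ∨ n < 2 * C.supp.ncard := by
    intro C
    by_contra! hC
    have hp := hpos C
    have hcard : C.supp.toFinset.card = C.supp.ncard := (Set.ncard_eq_toFinset_card' _).symm
    refine hG C.supp.toFinset (by omega) (by omega) ⟨?_, fun _ u hu => ?_⟩
    · intro u hu v hv huv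
      rw [Set.mem_toFinset] at hu hv
      exact hv (C.mem_supp_of_adj_mem_supp hu huv)
    · rw [Set.mem_toFinset] at hu
      obtain ⟨w, hw, hwu⟩ := Set.exists_ne_of_one_lt_ncard (by omega : 1 < C.supp.ncard) u
      have hreach : G.Reachable u w := SimpleGraph.ConnectedComponent.exact
        (((C.mem_supp_iff u).1 hu).trans ((C.mem_supp_iff w).1 hw).symm)
      obtain ⟨q⟩ := hreach
      cases q with
      | nil => exact absurd rfl hwu
      | cons h _ => exact ⟨_, Set.mem_toFinset.2 (C.mem_supp_of_adj_mem_supp hu h), h⟩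
  have hhalf : ∀ C : G.ConnectedComponent,
      (n : ℝ) / 2 ≤ (C.supp.ncard : ℝ) ↔ n ≤ 2 * C.supp.ncard := by
    intro C
    rw [div_le_iff₀ (by norm_num), mul_comm]
    exact_mod_cast Iff.rfl
  have hisol : ∀ C : G.ConnectedComponent, C.supp.ncard = 1 →
      ∀ v ∈ C.supp, G.neighborSet v = ∅ := by
    intro C hC v hv
    obtain ⟨a, ha⟩ := Set.ncard_eq_one.1 hC
    rw [Set.eq_empty_iff_forall_notMem]
    intro w hw
    have hw' := C.mem_supp_of_adj_mem_supp hv hw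
    rw [ha, Set.mem_singleton_iff] at hv hw'
    exact G.ne_of_adj hw (hv.trans hw'.symm)
  refine ⟨fun C => (hdich C).imp_right fun h => (hhalf C).2 h.le, ?_, ?_⟩
  · have hex : ∃ C : G.ConnectedComponent, n < 2 * C.supp.ncard := by
      by_contra! hall
      obtain ⟨S, -, hS⟩ := Finset.exists_subset_card_eq
        (show n / 2 ≤ (Finset.univ : Finset (Fin n)).card by simp; omega)
      refine hG S (by omega) (by omega) ⟨?_, fun h => ?_⟩
      · intro u _ v _ huv
        have h1 := (hdich (G.connectedComponentMk u)).resolve_right (not_lt.2 (hall _))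
        have h2 := hisol _ h1 u rfl
        exact Set.notMem_empty v (h2 ▸ huv)
      · rw [hS] at h
        have h2 : 2 ≤ n / 2 := by omega
        have h3 : n / 2 * 8 ≤ (n / 2) ^ 4 := by
          calc n / 2 * 8 = n / 2 * 2 ^ 3 := by norm_num
            _ ≤ n / 2 * (n / 2) ^ 3 := Nat.mul_le_mul_left _ (Nat.pow_le_pow_left h2 3)
            _ = _ := by ring
        omega
    obtain ⟨C, hC⟩ := hex
    refine ⟨C, (hhalf C).2 hC.le, fun D hD => ?_⟩
    by_contra hne
    have hD' := (hhalf D).1 hD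
    have hdisj : Disjoint D.supp C.supp :=
      SimpleGraph.pairwise_disjoint_supp_connectedComponent G hne
    have h1 := Set.ncard_union_eq hdisj (Set.toFinite _) (Set.toFinite _)
    have h2 : (D.supp ∪ C.supp).ncard ≤ n := by
      simpa using Set.ncard_le_card (D.supp ∪ C.supp)
    omega
  · intro C hC
    refine hisol C ((hdich C).resolve_right fun h => ?_)
    exact absurd ((hhalf C).2 h.le) (not_le.2 hC)

end Bad

section Estimates

lemma choose_le_exp {n s : ℕ} (hn : 0 < n) (hs : 0 < s) :
    (n.choose s : ℝ) ≤ Real.exp (s * (1 + Real.log n - Real.log s)) := by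
  have hn' : (0 : ℝ) < n := Nat.cast_pos.2 hn
  have hs' : (0 : ℝ) < s := Nat.cast_pos.2 hs
  have h1 := Real.pow_div_factorial_le_exp (s : ℝ) hs'.le s
  calc (n.choose s : ℝ) ≤ (n : ℝ) ^ s / s.factorial := Nat.choose_le_pow_div s n
    _ = (s : ℝ) ^ s / s.factorial * ((n : ℝ) / s) ^ s := by
        rw [div_pow]
        field_simp
    _ ≤ Real.exp s * ((n : ℝ) / s) ^ s := by gcongr
    _ = Real.exp (s * (1 + Real.log n - Real.log s)) := by
        rw [add_sub_assoc, ← Real.log_div hn'.ne' hs'.ne', mul_add, Real.exp_add, mul_one,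
          Real.exp_nat_mul (Real.log _), Real.exp_log (div_pos hn' hs')]

/-- The bound on the number of sets times the probability that one of them is bad, as a
purely analytic statement: `x` stands for `p * m_1(H)` and `q` for the probability. -/
lemma choose_mul_le {K L x q : ℝ} {n s : ℕ} (hn : 0 < n) (hs : 0 < s) (hK : 2 ≤ K)
    (hL : L = Real.log n) (hL₀ : 0 < L)
    (hx₁ : (1 - 1 / (16 * K)) * L ≤ x) (hx₂ : x ≤ 2 * L)
    (hL₁ : 1 + Real.log (16 * K ^ 2) ≤ L / (8 * K ^ 2)) (hL₂ : 1 ≤ 5 / 32 * L)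
    (hL₃ : 2 * K * L ≤ Real.exp (L / 4))
    (hq₁ : q ≤ Real.exp (-(s * x / (2 * K ^ 2))))
    (hq₂ : q ≤ Real.exp (-(s * x * (1 - K * s / n))))
    (hq₃ : s ^ 4 ≤ n → ∃ t : ℕ, (s : ℝ) ≤ t * K ∧
      q ≤ (s ^ 2 * (K * x / n)) ^ t * Real.exp (-(s * x * (1 - K * s / n)))) :
    n.choose s * q ≤ Real.exp (-(L / (8 * K ^ 2))) ^ s := by
  have hn' : (0 : ℝ) < n := Nat.cast_pos.2 hn
  have hs' : (0 : ℝ) < s := Nat.cast_pos.2 hs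
  have hK₀ : 0 < K := by linarith
  have hη : 1 / (16 * K) ≤ 1 / 32 := by
    apply one_div_le_one_div_of_le <;> linarith
  have hη₀ : 0 < 1 / (16 * K) := by positivity
  have hx₀ : 0 ≤ x := le_trans (mul_nonneg (by linarith) hL₀.le) hx₁
  have hch := choose_le_exp hn hs
  rw [← hL] at hch
  rw [← Real.exp_nat_mul]
  have hcmp : L / (8 * K ^ 2) ≤ L / (8 * K) / 2 := by
    rw [div_div]
    apply div_le_div_of_nonneg_left hL₀.le (by positivity)
    nlinarith
  have hcmp' : L / (8 * K) ≤ L / 16 := by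
    apply div_le_div_of_nonneg_left hL₀.le (by norm_num); linarith
  have combine : ∀ {A B : ℝ}, (n.choose s : ℝ) ≤ Real.exp (s * A) → q ≤ Real.exp (s * B) →
      A + B ≤ -(L / (8 * K ^ 2)) → n.choose s * q ≤ Real.exp (s * -(L / (8 * K ^ 2))) := by
    intro A B hA hB hAB
    calc n.choose s * q ≤ n.choose s * Real.exp (s * B) :=
          mul_le_mul_of_nonneg_left hB (Nat.cast_nonneg _)
      _ ≤ Real.exp (s * A) * Real.exp (s * B) :=
          mul_le_mul_of_nonneg_right hA (Real.exp_pos _).le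
      _ = Real.exp (s * (A + B)) := by rw [← Real.exp_add]; ring_nf
      _ ≤ _ := Real.exp_le_exp.2 (mul_le_mul_of_nonneg_left hAB hs'.le)
  by_cases hlarge : n / (16 * K ^ 2) < s
  · refine combine hch (hq₁.trans_eq (congrArg Real.exp
      (show _ = s * -(x / (2 * K ^ 2)) by ring))) ?_
    have h1 : L - Real.log s ≤ Real.log (16 * K ^ 2) := by
      rw [hL, sub_le_iff_le_add, ← Real.log_mul (by positivity) hs'.ne']
      apply Real.log_le_log hn'
      rw [div_lt_iff₀ (by positivity)] at hlarge
      linarith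
    have h2 : L / (4 * K ^ 2) ≤ x / (2 * K ^ 2) := by
      have : L / 2 ≤ x := by nlinarith
      calc L / (4 * K ^ 2) = L / 2 / (2 * K ^ 2) := by rw [div_div]; ring_nf
        _ ≤ _ := by gcongr
    have h3 : L / (4 * K ^ 2) = 2 * (L / (8 * K ^ 2)) := by field_simp; norm_num
    linarith
  · push Not at hlarge
    have hfrac : K * s / n ≤ 1 / (16 * K) := by
      rw [le_div_iff₀ (by positivity)] at hlarge
      rw [div_le_div_iff₀ hn' (by positivity)]
      nlinarith
    have hmain : (1 - 2 * (1 / (16 * K))) * L ≤ x * (1 - K * s / n) := by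
      calc (1 - 2 * (1 / (16 * K))) * L
          ≤ (1 - 1 / (16 * K)) * L * (1 - 1 / (16 * K)) := by nlinarith [sq_nonneg (1 / (16 * K))]
        _ ≤ x * (1 - K * s / n) :=
            mul_le_mul hx₁ (by linarith) (by linarith) hx₀
    have hid : 2 * (1 / (16 * K)) * L = L / (8 * K) := by field_simp; norm_num
    by_cases hsmall : s ^ 4 ≤ n
    · obtain ⟨t, ht, hq⟩ := hq₃ hsmall
      have hs4 : Real.log s ≤ L / 4 := by
        have : Real.log ((s : ℝ) ^ 4) ≤ Real.log n :=
          Real.log_le_log (by positivity) (by exact_mod_cast hsmall)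
        rw [Real.log_pow] at this
        push_cast at this
        linarith
      have hbase : (s : ℝ) ^ 2 * (K * x / n) ≤ Real.exp (-(L / 4)) := by
        have h1 : (s : ℝ) ^ 2 ≤ Real.exp (L / 2) := by
          rw [← Real.exp_log hs', ← Real.exp_nat_mul]
          apply Real.exp_le_exp.2
          push_cast
          linarith
        have h2 : K * x / n ≤ Real.exp (L / 4) * Real.exp (-L) := by
          rw [Real.exp_neg, hL, Real.exp_log hn', ← hL, ← div_eq_mul_inv]
          gcongr
          nlinarith
        calc (s : ℝ) ^ 2 * (K * x / n)
            ≤ Real.exp (L / 2) * (Real.exp (L / 4) * Real.exp (-L)) := by gcongr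
          _ = _ := by rw [← Real.exp_add, ← Real.exp_add]; ring_nf
      have hpow : ((s : ℝ) ^ 2 * (K * x / n)) ^ t ≤ Real.exp (s * -(L / (4 * K))) := by
        calc ((s : ℝ) ^ 2 * (K * x / n)) ^ t ≤ Real.exp (-(L / 4)) ^ t := by gcongr
          _ = Real.exp (t * -(L / 4)) := by rw [← Real.exp_nat_mul]
          _ ≤ _ := by
            apply Real.exp_le_exp.2
            have : s * (L / (4 * K)) ≤ t * K * (L / (4 * K)) := by gcongr
            have h2 : t * K * (L / (4 * K)) = t * (L / 4) := by field_simp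
            linarith
      have hchs : (n.choose s : ℝ) ≤ Real.exp (s * L) := by
        rw [Real.exp_nat_mul, hL, Real.exp_log hn']
        exact_mod_cast Nat.choose_le_pow n s
      refine combine hchs (B := -(L / (4 * K)) - x * (1 - K * s / n)) (hq.trans ?_) ?_
      · calc _ ≤ Real.exp (s * -(L / (4 * K))) * Real.exp (-(s * x * (1 - K * s / n))) := by
              gcongr
          _ = _ := by rw [← Real.exp_add]; ring_nf
      · have : L / (4 * K) = 2 * (L / (8 * K)) := by field_simp; norm_num
        have h8 : 0 ≤ L / (8 * K) := by positivity
        linarith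
    · have hs4 : L / 4 ≤ Real.log s := by
        have : Real.log n ≤ Real.log ((s : ℝ) ^ 4) :=
          Real.log_le_log hn' (by exact_mod_cast (not_le.1 hsmall).le)
        rw [Real.log_pow] at this
        push_cast at this
        linarith
      refine combine hch (hq₂.trans_eq (congrArg Real.exp
        (show _ = s * -(x * (1 - K * s / n)) by ring))) ?_
      linarith

end Estimates

section Main

variable {k n : ℕ} {H : SimpleGraph (Fin k)} {p : ℝ}

lemma copyCount_joint_mul_le (hk : 0 < k) (hiso : ∀ v, (H.neighborSet v).Nonempty)
    (hkn : k ≤ n) {u v : Fin n} (h : u ≠ v) :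
    copyCount H n Joint u v * n ≤ k * mr H n 1 := by
  have h1 := copyCount_joint_mul (H := H) hiso h
  have hn : 2 ≤ n := by
    by_contra! hn
    exact h (Fin.ext (by omega))
  obtain ⟨m, rfl⟩ : ∃ m, n = m + 1 := ⟨n - 1, by omega⟩
  obtain ⟨l, rfl⟩ : ∃ l, k = l + 1 := ⟨k - 1, by omega⟩
  simp only [Nat.add_sub_cancel] at h1
  have h2 : copyCount H (m + 1) Joint u v ≤ mr H (m + 1) 1 := by
    refine Nat.le_of_mul_le_mul_right (c := m) ?_ (by omega)
    rw [h1, mul_comm]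
    exact Nat.mul_le_mul_left _ (by omega)
  rw [mul_add, h1, mul_one, add_mul, one_mul]
  exact Nat.add_le_add_left h2 _

lemma card_mul_mr_le_mul_crossing (hiso : ∀ v, (H.neighborSet v).Nonempty) {u v : Fin n}
    (h : u ≠ v) (S : Finset (Fin n)) (hS : 2 * S.card ≤ n) :
    S.card * mr H n 1 ≤ 2 * k ^ 2 * (crossing H S).card := by
  have hn : 0 < n := u.pos
  have h1 := card_mul_compl_mul_le (H := H) hiso h S
  have h2 := mr_le_copyCount_adj_mul (H := H) h
  refine le_of_mul_le_mul_left (a := n) ?_ hn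
  calc n * (S.card * mr H n 1)
      ≤ (2 * (n - S.card)) * (S.card * (copyCount H n SimpleGraph.Adj u v * (n - 1))) :=
        Nat.mul_le_mul (by omega) (Nat.mul_le_mul_left _ h2)
    _ = 2 * (n - 1) * (S.card * (n - S.card) * copyCount H n SimpleGraph.Adj u v) := by ring
    _ ≤ 2 * n * (k ^ 2 * (crossing H S).card) := Nat.mul_le_mul (by omega) h1
    _ = _ := by ring

lemma choose_mul_motifProb_bad_le (hk : 2 ≤ k) (hiso : ∀ v, (H.neighborSet v).Nonempty)
    (h₀ : 0 ≤ p) (h₁ : p ≤ 1) {L : ℝ} (hkn : k ≤ n) (hL : L = Real.log n) (hL₀ : 0 < L)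
    (hx₁ : (1 - 1 / (16 * k)) * L ≤ p * mr H n 1) (hx₂ : p * mr H n 1 ≤ 2 * L)
    (hL₁ : 1 + Real.log (16 * k ^ 2) ≤ L / (8 * k ^ 2)) (hL₂ : 1 ≤ 5 / 32 * L)
    (hL₃ : 2 * k * L ≤ Real.exp (L / 4))
    {S : Finset (Fin n)} (hS₁ : 0 < S.card) (hS₂ : 2 * S.card ≤ n) :
    n.choose S.card * motifProb H n p (Bad S) ≤ Real.exp (-(L / (8 * k ^ 2))) ^ S.card := by
  have hn : 0 < n := by omega
  have hn' : (0 : ℝ) < n := Nat.cast_pos.2 hn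
  have hk' : (0 : ℝ) < k := by exact_mod_cast (by omega : 0 < k)
  have huv : (⟨0, by omega⟩ : Fin n) ≠ ⟨1, by omega⟩ := by simp
  have hcodeg := copyCount_joint_mul_le (by omega) hiso hkn huv
  have hlow := card_mul_mr_le (H := H) huv S
  have hlow' := card_mul_mr_le_mul_crossing hiso huv S hS₂
  have hinner := card_inner_le (H := H) huv S
  generalize copyCount H n Joint _ _ = e at hcodeg hlow hinner
  have hpe : p * e ≤ k * (p * mr H n 1) / n := by
    rw [le_div_iff₀ hn']
    have : (e : ℝ) * n ≤ k * mr H n 1 := by exact_mod_cast hcodeg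
    nlinarith
  have hcross : (S.card : ℝ) * (p * mr H n 1) * (1 - k * S.card / n) ≤
      p * (crossing H S).card := by
    have h1 : (S.card : ℝ) * mr H n 1 ≤ (crossing H S).card + S.card ^ 2 * e := by
      exact_mod_cast hlow
    have h2 := mul_le_mul_of_nonneg_left h1 h₀
    have h3 := mul_le_mul_of_nonneg_left hpe (sq_nonneg (S.card : ℝ))
    have h4 : (S.card : ℝ) * (p * mr H n 1) * (1 - k * S.card / n) =
        p * (S.card * mr H n 1) - S.card ^ 2 * (k * (p * mr H n 1) / n) := by ring
    linarith
  have hq := one_sub_pow_le_exp h₁ (crossing H S).card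
  refine choose_mul_le hn hS₁ (by exact_mod_cast hk) hL hL₀ hx₁ hx₂ hL₁ hL₂ hL₃ ?_ ?_ ?_
  · refine (motifProb_bad_le h₀ h₁ S).trans (hq.trans (Real.exp_le_exp.2 (neg_le_neg ?_)))
    rw [div_le_iff₀ (by positivity)]
    have : (S.card : ℝ) * mr H n 1 ≤ 2 * k ^ 2 * (crossing H S).card := by
      exact_mod_cast hlow'
    nlinarith
  · exact (motifProb_bad_le h₀ h₁ S).trans
      (hq.trans (Real.exp_le_exp.2 (neg_le_neg hcross)))
  · intro hsmall
    refine ⟨(S.card + k - 1) / k, ?_, ?_⟩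
    · have h1 := Nat.div_add_mod (S.card + k - 1) k
      have h2 := Nat.mod_lt (S.card + k - 1) (by omega : k > 0)
      rw [mul_comm] at h1
      exact_mod_cast (by omega : S.card ≤ (S.card + k - 1) / k * k)
    · have h1 := Nat.div_mul_le_self (S.card + k - 1) k
      refine (motifProb_bad_le_of_small hiso h₀ h₁ S hsmall (t := (S.card + k - 1) / k)
        (by omega)).trans ?_
      have h2 : ((inner H S).card : ℝ) * p ≤ S.card ^ 2 * (k * (p * mr H n 1) / n) := by
        have h3 : ((inner H S).card : ℝ) ≤ S.card ^ 2 * e := by exact_mod_cast hinner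
        calc ((inner H S).card : ℝ) * p ≤ S.card ^ 2 * e * p := by gcongr
          _ = S.card ^ 2 * (p * e) := by ring
          _ ≤ _ := by gcongr
      have h4 : 0 ≤ 1 - p := sub_nonneg.2 h₁
      exact mul_le_mul (pow_le_pow_left₀ (by positivity) h2 _)
        (hq.trans (Real.exp_le_exp.2 (neg_le_neg hcross))) (pow_nonneg h4 _) (by positivity)

lemma motifProb_exists_bad_le (h₀ : 0 ≤ p) (h₁ : p ≤ 1) {y : ℝ} (hy₀ : 0 ≤ y) (hy₁ : y < 1)
    (hbad : ∀ S : Finset (Fin n), 0 < S.card → 2 * S.card ≤ n →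
      n.choose S.card * motifProb H n p (Bad S) ≤ y ^ S.card) :
    motifProb H n p (fun G => ∃ S : Finset (Fin n), 2 ≤ S.card ∧ 2 * S.card ≤ n ∧ Bad S G) ≤
      y ^ 2 / (1 - y) := by
  have hsize : ∀ s ∈ Finset.Ico 2 (n / 2 + 1),
      selProb H n p (fun ω => ∃ S ∈ Finset.powersetCard s Finset.univ, Bad S (graphOf ω)) ≤
        y ^ s := by
    intro s hs
    rw [Finset.mem_Ico] at hs
    have hpos : (0 : ℝ) < n.choose s := by
      exact_mod_cast Nat.choose_pos (by omega)
    refine (selProb_exists_le h₀ h₁ _ _).trans ?_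
    calc ∑ S ∈ Finset.powersetCard s Finset.univ, motifProb H n p (Bad S)
        ≤ ∑ S ∈ Finset.powersetCard s (Finset.univ : Finset (Fin n)), y ^ s / n.choose s := by
          refine Finset.sum_le_sum fun S hS => ?_
          have hcard := (Finset.mem_powersetCard.1 hS).2
          have := hbad S (by omega) (by omega)
          rw [hcard] at this
          rw [le_div_iff₀ hpos]
          linarith
      _ = y ^ s := by
          rw [Finset.sum_const, Finset.card_powersetCard, Finset.card_univ, Fintype.card_fin,
            nsmul_eq_mul, mul_div_cancel₀ _ hpos.ne']
  calc _ ≤ selProb H n p (fun ω => ∃ s ∈ Finset.Ico 2 (n / 2 + 1),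
        ∃ S ∈ Finset.powersetCard s Finset.univ, Bad S (graphOf ω)) := by
        refine selProb_mono h₀ h₁ ?_
        rintro ω ⟨S, hS₁, hS₂, hS⟩
        exact ⟨S.card, Finset.mem_Ico.2 ⟨hS₁, by omega⟩, S, by simp, hS⟩
    _ ≤ ∑ s ∈ Finset.Ico 2 (n / 2 + 1), y ^ s :=
        (selProb_exists_le h₀ h₁ _ _).trans (Finset.sum_le_sum hsize)
    _ ≤ _ := geom_sum_Ico_le_of_lt_one hy₀ hy₁

end Main

/-- **Component structure.**  If `p · m_1(H) = ln n ± o(ln n)` then w.h.p. every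
connected component of `G(H,n,p)` has cardinality `1` or at least `n/2`; in
particular, w.h.p. there is a unique component of size at least `n/2` and every
other component is a single (isolated) vertex. -/
theorem component_dichotomy {k : ℕ} (H : SimpleGraph (Fin k)) (hk : 0 < k)
    (hiso : ∀ v, (H.neighborSet v).Nonempty)
    (p : ℕ → ℝ) (hp : ∀ n, 0 ≤ p n ∧ p n ≤ 1)
    (hmean : Tendsto
      (fun n => (p n * (mr H n 1 : ℝ) - Real.log n) / Real.log n) atTop (nhds 0)) :
    Tendsto (fun n => motifProb H n (p n) (fun G =>
        (∀ C : G.ConnectedComponent, C.supp.ncard = 1 ∨ (n : ℝ) / 2 ≤ (C.supp.ncard : ℝ)) ∧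
        (∃! C : G.ConnectedComponent, (n : ℝ) / 2 ≤ (C.supp.ncard : ℝ)) ∧
        (∀ C : G.ConnectedComponent, (C.supp.ncard : ℝ) < (n : ℝ) / 2 →
          ∀ v ∈ C.supp, G.neighborSet v = ∅)))
      atTop (nhds 1) := by
  have hk₂ : 2 ≤ k := by
    obtain ⟨w, hw⟩ := hiso ⟨0, hk⟩
    have h1 := H.ne_of_adj hw
    have h2 : (0 : ℕ) ≠ w := fun h => h1 (Fin.ext h)
    have := w.2
    omega
  have hk' : (0 : ℝ) < k := Nat.cast_pos.2 hk
  have hlog : Tendsto (fun n : ℕ => Real.log n) atTop atTop :=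
    Real.tendsto_log_atTop.comp tendsto_natCast_atTop_atTop
  have hη : (0 : ℝ) < 1 / (16 * k) := by positivity
  have hη₁ : 1 / (16 * (k : ℝ)) ≤ 1 := by
    rw [div_le_one (by positivity)]
    have : (1 : ℝ) ≤ k := by exact_mod_cast hk
    linarith
  have hexp : ∀ᶠ L : ℝ in atTop, 2 * k * L ≤ Real.exp (L / 4) := by
    have h1 : Tendsto (fun L : ℝ => Real.exp (L / 4) / (L / 4)) atTop atTop :=
      (by simpa using Real.tendsto_exp_div_pow_atTop 1 :
        Tendsto (fun z : ℝ => Real.exp z / z) atTop atTop).comp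
        (tendsto_id.atTop_div_const (by norm_num))
    filter_upwards [h1.eventually_ge_atTop (8 * k), eventually_gt_atTop 0] with L hL hL₀
    rw [le_div_iff₀ (by positivity)] at hL
    linarith
  set y : ℕ → ℝ := fun n => Real.exp (-(Real.log n / (8 * k ^ 2))) with hy
  have hy_lim : Tendsto y atTop (nhds 0) :=
    Real.tendsto_exp_neg_atTop_nhds_zero.comp (hlog.atTop_div_const (by positivity))
  have hbound : Tendsto (fun n => 1 - y n ^ 2 / (1 - y n)) atTop (nhds 1) := by
    have h1 : Tendsto (fun n => 1 - y n) atTop (nhds (1 - 0)) := hy_lim.const_sub 1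
    simpa using ((hy_lim.pow 2).div h1 (by norm_num)).const_sub 1
  refine tendsto_of_tendsto_of_tendsto_of_le_of_le' hbound tendsto_const_nhds ?_ ?_
  · filter_upwards [eventually_ge_atTop k, eventually_ge_atTop 4,
      hlog.eventually_gt_atTop 0, hlog.eventually hexp,
      hlog.eventually_ge_atTop (32 / 5),
      hlog.eventually_ge_atTop ((1 + Real.log (16 * k ^ 2)) * (8 * k ^ 2)),
      hmean.eventually (Metric.ball_mem_nhds 0 hη)]
      with n hkn hn hL₀ hL₃ hL₂ hL₁ hx
    obtain ⟨h₀, h₁⟩ := hp n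
    rw [Real.dist_eq, sub_zero, abs_lt, lt_div_iff₀ hL₀,
      div_lt_iff₀ hL₀] at hx
    have hy₁ : y n < 1 := Real.exp_lt_one_iff.2 (neg_lt_zero.2 (by positivity))
    have hbad := motifProb_exists_bad_le h₀ h₁ (Real.exp_pos _).le hy₁ fun S hS₁ hS₂ =>
      choose_mul_motifProb_bad_le (S := S) hk₂ hiso h₀ h₁ hkn rfl hL₀ (by linarith [hx.1])
        (by nlinarith [hx.2]) (by rw [le_div_iff₀ (by positivity)]; exact hL₁)
        (by linarith) hL₃ hS₁ hS₂
    have hnot := selProb_not (H := H) (p := p n) (fun ω => ∃ S : Finset (Fin n),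
      2 ≤ S.card ∧ 2 * S.card ≤ n ∧ Bad S (graphOf ω))
    calc 1 - y n ^ 2 / (1 - y n) ≤ _ := sub_le_sub_left hbad 1
      _ = _ := hnot.symm
      _ ≤ _ := selProb_mono h₀ h₁ fun ω hω =>
          components_of_not_bad hn _ fun S hS₁ hS₂ hS => hω ⟨S, hS₁, hS₂, hS⟩
  · refine Eventually.of_forall fun n => ?_
    exact (selProb_mono (hp n).1 (hp n).2 fun _ _ => trivial).trans_eq selProb_true

end RandomMotif
end
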